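/- arXiv:1105.4435 — 2 statements merged into one kernel-verified Lean document; each statement's English description precedes it below -/
import Mathlib

section
/- Let f: X → ℝ^m be a function definable in an o-minimal structure with definable domain X ⊂ ℝⁿ. Then there exist definable sets X₀, X₁, …, X_M with X = X₀ ∪ X₁ ∪ ⋯ ∪ X_M such that f restricted to each of X₁, …, X_M is injective and the fibers of f restricted to X₀ contain no isolated points. -/
open Set

/-- Real semialgebraic subsets of `ℝⁿ`: the smallest class containing the zero sets and
positivity sets of real polynomials that is stable under finite unions, intersections and
complements. -/
inductive IsSemialgebraic : {n : ℕ} → Set (Fin n → ℝ) → Prop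
  | eq {n : ℕ} (p : MvPolynomial (Fin n) ℝ) :
      IsSemialgebraic {x | MvPolynomial.eval x p = 0}
  | lt {n : ℕ} (p : MvPolynomial (Fin n) ℝ) :
      IsSemialgebraic {x | 0 < MvPolynomial.eval x p}
  | union {n : ℕ} {s t : Set (Fin n → ℝ)} :
      IsSemialgebraic s → IsSemialgebraic t → IsSemialgebraic (s ∪ t)
  | inter {n : ℕ} {s t : Set (Fin n → ℝ)} :
      IsSemialgebraic s → IsSemialgebraic t → IsSemialgebraic (s ∩ t)
  | compl {n : ℕ} {s : Set (Fin n → ℝ)} : IsSemialgebraic s → IsSemialgebraic sᶜ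

/-- An o-minimal structure `𝔖 = (S₁, S₂, …)`: each `Sₙ` is a collection of subsets of
`ℝⁿ` closed under intersections and complements, containing all real semialgebraic sets,
closed under Cartesian products and coordinate projections, and such that every set in
`S₁` is a finite union of points and open (possibly unbounded) intervals. -/
structure OMinimalStructure where
  sets : (n : ℕ) → Set (Set (Fin n → ℝ))
  inter_mem : ∀ {n : ℕ} {s t : Set (Fin n → ℝ)},
      s ∈ sets n → t ∈ sets n → s ∩ t ∈ sets n
  compl_mem : ∀ {n : ℕ} {s : Set (Fin n → ℝ)}, s ∈ sets n → sᶜ ∈ sets n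
  semialgebraic_mem : ∀ {n : ℕ} {s : Set (Fin n → ℝ)},
      IsSemialgebraic s → s ∈ sets n
  prod_mem : ∀ {n m : ℕ} {s : Set (Fin n → ℝ)} {t : Set (Fin m → ℝ)},
      s ∈ sets n → t ∈ sets m →
      {z : Fin (n + m) → ℝ |
        (fun i => z (Fin.castAdd m i)) ∈ s ∧ (fun j => z (Fin.natAdd n j)) ∈ t} ∈
        sets (n + m)
  proj_mem : ∀ {n m : ℕ} {s : Set (Fin (n + m) → ℝ)}, s ∈ sets (n + m) →
      {x : Fin n → ℝ | ∃ z ∈ s, x = fun i => z (Fin.castAdd m i)} ∈ sets n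
  o_minimal : ∀ {s : Set (Fin 1 → ℝ)}, s ∈ sets 1 →
      ∃ (F : Finset ℝ) (I : Finset (Set ℝ)),
        (∀ J ∈ I, ∃ a b : ℝ, J = Ioo a b ∨ J = Ioi a ∨ J = Iio b ∨ J = univ) ∧
        (fun x : Fin 1 → ℝ => x 0) '' s = ↑F ∪ ⋃₀ ↑I

/-- The graph of a function `f` with domain `X ⊂ ℝⁿ` and values in `ℝ^m`, viewed as a
subset of `ℝ^(n+m)`. A function is definable in `𝔖` if its graph lies in `S_{n+m}`. -/
def functionGraph {n m : ℕ} (X : Set (Fin n → ℝ)) (f : (Fin n → ℝ) → (Fin m → ℝ)) :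
    Set (Fin (n + m) → ℝ) :=
  {z | (fun i => z (Fin.castAdd m i)) ∈ X ∧
    (fun j => z (Fin.natAdd n j)) = f (fun i => z (Fin.castAdd m i))}

namespace OMin

/-- Types identified with some `ℝ^d`. -/
class Ctx (E : Type) where
  dim : ℕ
  eqv : E ≃ (Fin dim → ℝ)

instance ctxReal : Ctx ℝ := ⟨1, (Equiv.funUnique (Fin 1) ℝ).symm⟩

instance ctxFin (n : ℕ) : Ctx (Fin n → ℝ) := ⟨n, Equiv.refl _⟩

instance ctxProd (E F : Type) [Ctx E] [Ctx F] : Ctx (E × F) :=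
  ⟨Ctx.dim E + Ctx.dim F,
   { toFun := fun p => Fin.append (Ctx.eqv p.1) (Ctx.eqv p.2)
     invFun := fun z => (Ctx.eqv.symm (fun i => z (Fin.castAdd _ i)),
       Ctx.eqv.symm (fun j => z (Fin.natAdd _ j)))
     left_inv := fun p => by simp
     right_inv := fun z => by
       ext i
       refine Fin.addCases (fun i => ?_) (fun i => ?_) i <;> simp }⟩

variable {E F G : Type} [Ctx E] [Ctx F] [Ctx G]

/-- Definable predicate. -/
def Dfn (S : OMinimalStructure) (P : E → Prop) : Prop :=
  {z : Fin (Ctx.dim E) → ℝ | P (Ctx.eqv.symm z)} ∈ S.sets (Ctx.dim E)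

/-- Polynomial map. -/
def Poly (g : E → F) : Prop :=
  ∀ j : Fin (Ctx.dim F), ∃ q : MvPolynomial (Fin (Ctx.dim E)) ℝ,
    ∀ x, Ctx.eqv (g x) j = MvPolynomial.eval (Ctx.eqv x) q

theorem Poly.id : Poly (fun x : E => x) := fun j => ⟨.X j, by simp⟩

theorem poly_real {h : E → ℝ} : Poly h ↔ ∃ q : MvPolynomial (Fin (Ctx.dim E)) ℝ,
    ∀ x, h x = MvPolynomial.eval (Ctx.eqv x) q :=
  ⟨fun H => H (0 : Fin 1), fun H _ => H⟩

theorem poly_fin {n : ℕ} {h : E → Fin n → ℝ} : Poly h ↔ ∀ i, Poly (fun x => h x i) :=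
  ⟨fun H i => poly_real.2 (H i), fun H i => poly_real.1 (H i)⟩

theorem Poly.fst {g : E → F × G} (h : Poly g) : Poly (fun x => (g x).1) := fun j => by
  obtain ⟨q, hq⟩ := h (Fin.castAdd _ j)
  exact ⟨q, fun x => by rw [← hq]; exact (Fin.append_left _ _ _).symm⟩

theorem Poly.snd {g : E → F × G} (h : Poly g) : Poly (fun x => (g x).2) := fun j => by
  obtain ⟨q, hq⟩ := h (Fin.natAdd _ j)
  exact ⟨q, fun x => by rw [← hq]; exact (Fin.append_right _ _ _).symm⟩

theorem Poly.pair {g : E → F} {h : E → G} (hg : Poly g) (hh : Poly h) :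
    Poly (fun x => (g x, h x)) := fun j => by
  refine Fin.addCases (fun i => ?_) (fun i => ?_) j
  · obtain ⟨q, hq⟩ := hg i
    exact ⟨q, fun x => by rw [← hq]; exact Fin.append_left _ _ _⟩
  · obtain ⟨q, hq⟩ := hh i
    exact ⟨q, fun x => by rw [← hq]; exact Fin.append_right _ _ _⟩

theorem Poly.const (c : F) : Poly (fun _ : E => c) := fun j => ⟨.C (Ctx.eqv c j), by simp⟩

theorem Poly.add {g h : E → ℝ} (hg : Poly g) (hh : Poly h) : Poly (fun x => g x + h x) := by
  rw [poly_real] at *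
  obtain ⟨p, hp⟩ := hg
  obtain ⟨q, hq⟩ := hh
  exact ⟨p + q, fun x => by simp [hp, hq]⟩

theorem Poly.coord {g : E → F} (hg : Poly g) (i : Fin (Ctx.dim F)) :
    Poly (fun x => Ctx.eqv (g x) i) := poly_real.2 (hg i)

theorem Poly.app {n : ℕ} {g : E → Fin n → ℝ} (hg : Poly g) (i : Fin n) :
    Poly (fun x => g x i) := poly_fin.1 hg i

theorem Poly.cons {n : ℕ} {t : E → ℝ} {y : E → Fin n → ℝ} (ht : Poly t) (hy : Poly y) :
    Poly (fun x => (Fin.cons (t x) (y x) : Fin (n + 1) → ℝ)) := by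
  rw [poly_fin]
  intro i
  refine Fin.cases ?_ (fun i => ?_) i
  · simpa using ht
  · simpa using hy.app i

variable {S : OMinimalStructure}

theorem Dfn.not {P : E → Prop} (h : Dfn S P) : Dfn S (fun x => ¬ P x) := S.compl_mem h

theorem Dfn.and {P Q : E → Prop} (h : Dfn S P) (h' : Dfn S Q) : Dfn S (fun x => P x ∧ Q x) :=
  S.inter_mem h h'

theorem Dfn.congr {P Q : E → Prop} (h : Dfn S P) (h' : ∀ x, P x ↔ Q x) : Dfn S Q := by
  have : P = Q := funext fun x => propext (h' x)
  exact this ▸ h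

theorem Dfn.or {P Q : E → Prop} (h : Dfn S P) (h' : Dfn S Q) : Dfn S (fun x => P x ∨ Q x) :=
  (h.not.and h'.not).not.congr fun x => by tauto

theorem Dfn.imp {P Q : E → Prop} (h : Dfn S P) (h' : Dfn S Q) : Dfn S (fun x => P x → Q x) :=
  (h.and h'.not).not.congr fun x => by tauto

theorem Dfn.eq {g h : E → ℝ} (hg : Poly g) (hh : Poly h) : Dfn S (fun x => g x = h x) := by
  rw [poly_real] at *
  obtain ⟨p, hp⟩ := hg
  obtain ⟨q, hq⟩ := hh
  have := S.semialgebraic_mem (IsSemialgebraic.eq (p - q))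
  simpa [Dfn, hp, hq, sub_eq_zero] using this

theorem Dfn.lt {g h : E → ℝ} (hg : Poly g) (hh : Poly h) : Dfn S (fun x => g x < h x) := by
  rw [poly_real] at *
  obtain ⟨p, hp⟩ := hg
  obtain ⟨q, hq⟩ := hh
  have := S.semialgebraic_mem (IsSemialgebraic.lt (q - p))
  simpa [Dfn, hp, hq, sub_pos] using this

theorem Dfn.true : Dfn S (fun _ : E => True) :=
  (Dfn.eq (Poly.const (E := E) (0 : ℝ)) (Poly.const 0)).congr fun x => by simp

theorem Dfn.cst (p : Prop) : Dfn S (fun _ : E => p) := by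
  by_cases h : p
  · exact Dfn.true.congr fun _ => by simp [h]
  · exact Dfn.true.not.congr fun _ => by simp [h]

theorem Dfn.ex {P : E → F → Prop} (h : Dfn S (fun p : E × F => P p.1 p.2)) :
    Dfn S (fun x => ∃ y, P x y) := by
  have := S.proj_mem (n := Ctx.dim E) (m := Ctx.dim F) h
  unfold Dfn
  convert this using 1
  ext x
  constructor
  · rintro ⟨y, hy⟩
    refine ⟨Ctx.eqv (E := E × F) (Ctx.eqv.symm x, y), ?_, ?_⟩
    · change P (Ctx.eqv.symm (Ctx.eqv (Ctx.eqv.symm x, y))).1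
        (Ctx.eqv.symm (Ctx.eqv (Ctx.eqv.symm x, y))).2
      simpa using hy
    · funext i
      simp [Ctx.eqv]
  · rintro ⟨z, hz, rfl⟩
    exact ⟨_, hz⟩

theorem Dfn.all {P : E → F → Prop} (h : Dfn S (fun p : E × F => P p.1 p.2)) :
    Dfn S (fun x => ∀ y, P x y) :=
  (Dfn.ex (P := fun x y => ¬ P x y) h.not).not.congr fun x => by simp

theorem Dfn.allFin {ι : Type} [Finite ι] {P : ι → E → Prop} (h : ∀ i, Dfn S (P i)) :
    Dfn S (fun x => ∀ i, P i x) := by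
  have : Fintype ι := Fintype.ofFinite ι
  classical
  have key : ∀ s : Finset ι, Dfn S (fun x => ∀ i ∈ s, P i x) := by
    intro s
    induction s using Finset.induction_on with
    | empty => exact Dfn.true.congr fun x => by simp
    | insert a s _ ih => exact ((h a).and ih).congr fun x => by simp
  exact (key Finset.univ).congr fun x => by simp

theorem Dfn.exFin {ι : Type} [Finite ι] {P : ι → E → Prop} (h : ∀ i, Dfn S (P i)) :
    Dfn S (fun x => ∃ i, P i x) :=
  (Dfn.allFin (fun i => (h i).not)).not.congr fun x => by simp

theorem Dfn.comp {P : F → Prop} {g : E → F} (h : Dfn S P) (hg : Poly g) :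
    Dfn S (fun x => P (g x)) := by
  have h0 : Dfn S (fun p : E × F => True ∧ P p.2) := S.prod_mem (Dfn.true (E := E)) h
  have h1 : Dfn S (fun p : E × F => P p.2) := h0.congr fun x => by simp
  have hg' : Poly (fun p : E × F => g p.1) := fun j => by
    obtain ⟨q, hq⟩ := hg j
    refine ⟨MvPolynomial.rename (Fin.castAdd _) q, fun x => ?_⟩
    rw [hq, MvPolynomial.eval_rename]
    congr 2
    funext i
    simp [Ctx.eqv]
  have h2 : Dfn S (fun p : E × F => ∀ j, Ctx.eqv p.2 j = Ctx.eqv (g p.1) j) :=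
    Dfn.allFin fun j => Dfn.eq (Poly.id.snd.coord j) (hg'.coord j)
  refine (Dfn.ex (P := fun x y => (∀ j, Ctx.eqv y j = Ctx.eqv (g x) j) ∧ P y)
    (h2.and h1)).congr fun x => ?_
  constructor
  · rintro ⟨y, hy, hp⟩
    have : y = g x := Ctx.eqv.injective (funext hy)
    exact this ▸ hp
  · intro hp
    exact ⟨_, fun _ => rfl, hp⟩

theorem Dfn.comp₂ {A : E → F → Prop} (h : Dfn S (fun q : E × F => A q.1 q.2))
    {g : G → E} {k : G → F} (hg : Poly g) (hk : Poly k) : Dfn S (fun x => A (g x) (k x)) :=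
  h.comp (hg.pair hk)

theorem Dfn.eqv {g h : E → F} (hg : Poly g) (hh : Poly h) : Dfn S (fun x => g x = h x) :=
  (Dfn.allFin fun j => Dfn.eq (hg.coord j) (hh.coord j)).congr fun x =>
    ⟨fun H => Ctx.eqv.injective (funext H), fun H _ => by rw [H]⟩

/-- O-minimality: a definable subset of `ℝ` is finite or contains an interval. -/
theorem Dfn.dichotomy {P : ℝ → Prop} (h : Dfn S P) :
    {x | P x}.Finite ∨ ∃ a b, a < b ∧ Ioo a b ⊆ {x | P x} := by
  obtain ⟨Fs, I, hI, heq⟩ := S.o_minimal h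
  have heq' : {x | P x} = ↑Fs ∪ ⋃₀ (↑I : Set (Set ℝ)) := by
    rw [← heq]
    ext x
    constructor
    · intro hx
      exact ⟨fun _ => x, hx, rfl⟩
    · rintro ⟨z, hz, rfl⟩
      exact hz
  by_cases hc : ∃ a b : ℝ, a < b ∧ Ioo a b ⊆ {x | P x}
  · exact Or.inr hc
  left
  rw [heq']
  have : ⋃₀ (↑I : Set (Set ℝ)) = ∅ := by
    rw [sUnion_eq_empty]
    intro J hJ
    by_contra hne
    apply hc
    have hsub : J ⊆ {x | P x} := by
      rw [heq']
      exact (subset_sUnion_of_mem hJ).trans subset_union_right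
    obtain ⟨a, b, hab⟩ := hI J hJ
    rcases hab with rfl | rfl | rfl | rfl
    · obtain ⟨x, hx⟩ := nonempty_iff_ne_empty.2 hne
      exact ⟨a, b, hx.1.trans hx.2, hsub⟩
    · exact ⟨a, a + 1, by linarith, Ioo_subset_Ioi_self.trans hsub⟩
    · exact ⟨b - 1, b, by linarith, Ioo_subset_Iio_self.trans hsub⟩
    · exact ⟨0, 1, by norm_num, (subset_univ _).trans hsub⟩
  rw [this, union_empty]
  exact Fs.finite_toSet

theorem Dfn.finite_of_countable {P : ℝ → Prop} (h : Dfn S P) (hc : {x | P x}.Countable) :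
    {x | P x}.Finite := by
  rcases h.dichotomy with h | ⟨a, b, hab, hsub⟩
  · exact h
  · exact absurd (hc.mono hsub) (Cardinal.Real.Ioo_countable_iff.not.2 (not_le.2 hab))

/-- Sup-distance less than `r`, in coordinates. -/
def Near (r : ℝ) (x x' : F) : Prop :=
  ∀ i, Ctx.eqv x i < Ctx.eqv x' i + r ∧ Ctx.eqv x' i < Ctx.eqv x i + r

def Sep (r : ℝ) (T : F → Prop) : Prop :=
  ∀ x x', T x → T x' → Near (r + r) x x' → x = x'

def Cover (r : ℝ) (T T' : F → Prop) : Prop :=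
  ∀ x, T x → ∃ x', T' x' ∧ Near r x x'

def Match (T T' : F → Prop) : Prop :=
  ∃ r : ℝ, 0 < r ∧ (Sep r T ∧ Sep r T') ∧ (Cover r T T' ∧ Cover r T' T)

theorem ncard_le_of_cover {T T' : F → Prop} {r : ℝ} (hs : Sep r T) (hc : Cover r T T')
    (hfin : {x | T' x}.Finite) : {x | T x}.ncard ≤ {x | T' x}.ncard := by
  choose! g hg hn using hc
  refine Set.ncard_le_ncard_of_injOn g (fun x hx => hg x hx) ?_ hfin
  intro x hx x' hx' he
  refine hs x x' hx hx' fun i => ?_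
  have h1 := hn x hx i
  have h2 := hn x' hx' i
  rw [he] at h1
  constructor <;> linarith [h1.1, h1.2, h2.1, h2.2]

theorem Match.ncard_eq {T T' : F → Prop} (h : Match T T')
    (hT : {x | T x}.Finite) (hT' : {x | T' x}.Finite) :
    {x | T x}.ncard = {x | T' x}.ncard := by
  obtain ⟨r, _, ⟨h1, h2⟩, h3, h4⟩ := h
  exact le_antisymm (ncard_le_of_cover h1 h3 hT') (ncard_le_of_cover h2 h4 hT)

def Bin (r : ℝ) (k : Fin (Ctx.dim F) → ℤ) (x : F) : Prop :=
  ∀ i, ¬ (Ctx.eqv x i < k i * r) ∧ Ctx.eqv x i < k i * r + r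

def HasCode (r : ℝ) (c : Finset (Fin (Ctx.dim F) → ℤ)) (T : F → Prop) : Prop :=
  Sep r T ∧ (∀ x, T x → ∃ k : c, Bin r k x) ∧ ∀ k : c, ∃ x, T x ∧ Bin r k x

theorem HasCode.cover {r : ℝ} {c : Finset (Fin (Ctx.dim F) → ℤ)} {T T' : F → Prop}
    (h : HasCode r c T) (h' : HasCode r c T') : Cover r T T' := by
  intro x hx
  obtain ⟨k, hk⟩ := h.2.1 x hx
  obtain ⟨x', hx', hk'⟩ := h'.2.2 k
  refine ⟨x', hx', fun i => ?_⟩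
  have h1 := hk i
  have h2 := hk' i
  rw [not_lt] at h1 h2
  constructor <;> linarith [h1.1, h1.2, h2.1, h2.2]

theorem HasCode.match {r : ℝ} {c : Finset (Fin (Ctx.dim F) → ℤ)} {T T' : F → Prop}
    (hr : 0 < r) (h : HasCode r c T) (h' : HasCode r c T') : Match T T' :=
  ⟨r, hr, ⟨h.1, h'.1⟩, h.cover h', h'.cover h⟩

theorem exists_sep {T : F → Prop} (hT : {x | T x}.Finite) :
    ∃ n : ℕ, Sep (1 / ((n : ℝ) + 1)) T := by
  have key : ∀ᶠ n : ℕ in Filter.atTop, ∀ x ∈ {x | T x}, ∀ x' ∈ {x | T x},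
      Near (1 / ((n : ℝ) + 1) + 1 / ((n : ℝ) + 1)) x x' → x = x' := by
    refine (Filter.eventually_all_finite hT).2 fun x _ =>
      (Filter.eventually_all_finite hT).2 fun x' _ => ?_
    by_cases hxx : x = x'
    · exact Filter.Eventually.of_forall fun _ _ => hxx
    have : ∃ i, Ctx.eqv x i ≠ Ctx.eqv x' i := by
      by_contra hcon
      push Not at hcon
      exact hxx (Ctx.eqv.injective (funext hcon))
    obtain ⟨i, hi⟩ := this
    have hpos : 0 < |Ctx.eqv x i - Ctx.eqv x' i| / 2 := by
      have := abs_pos.2 (sub_ne_zero.2 hi)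
      linarith
    have ht := tendsto_one_div_add_atTop_nhds_zero_nat (𝕜 := ℝ)
    filter_upwards [ht.eventually (gt_mem_nhds hpos)] with n hn hnear
    exfalso
    have h1 := hnear i
    rcases abs_cases (Ctx.eqv x i - Ctx.eqv x' i) with h | h <;> linarith [h1.1, h1.2, h.1]
  obtain ⟨n, hn⟩ := key.exists
  exact ⟨n, fun x x' hx hx' => hn x hx x' hx'⟩

theorem exists_code {T : F → Prop} (hT : {x | T x}.Finite) :
    ∃ q : ℕ × Finset (Fin (Ctx.dim F) → ℤ), HasCode (1 / ((q.1 : ℝ) + 1)) q.2 T := by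
  classical
  obtain ⟨n, hn⟩ := exists_sep hT
  set r : ℝ := 1 / ((n : ℝ) + 1) with hr
  have hr0 : 0 < r := by positivity
  let b : F → Fin (Ctx.dim F) → ℤ := fun x i => ⌊Ctx.eqv x i / r⌋
  have hb : ∀ x, Bin r (b x) x := by
    intro x i
    have h1 := Int.floor_le (Ctx.eqv x i / r)
    have h2 := Int.lt_floor_add_one (Ctx.eqv x i / r)
    rw [le_div_iff₀ hr0] at h1
    rw [div_lt_iff₀ hr0] at h2
    refine ⟨not_lt.2 h1, ?_⟩
    have : ((⌊Ctx.eqv x i / r⌋ : ℝ) + 1) * r = ⌊Ctx.eqv x i / r⌋ * r + r := by ring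
    rw [this] at h2
    exact h2
  refine ⟨⟨n, hT.toFinset.image b⟩, hn, ?_, ?_⟩
  · intro x hx
    refine ⟨⟨b x, ?_⟩, hb x⟩
    exact Finset.mem_image_of_mem _ (hT.mem_toFinset.2 hx)
  · rintro ⟨k, hk⟩
    obtain ⟨x, hx, rfl⟩ := Finset.mem_image.1 hk
    exact ⟨x, hT.mem_toFinset.1 hx, hb x⟩

theorem Dfn.near {r : E → ℝ} {x x' : E → F} (hr : Poly r) (hx : Poly x) (hx' : Poly x') :
    Dfn S (fun e => Near (r e) (x e) (x' e)) :=
  Dfn.allFin fun i => (Dfn.lt (hx.coord i) ((hx'.coord i).add hr)).and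
    (Dfn.lt (hx'.coord i) ((hx.coord i).add hr))

theorem Poly.comp {g : F → G} {h : E → F} (hg : Poly g) (hh : Poly h) :
    Poly (fun x => g (h x)) := fun j => by
  obtain ⟨q, hq⟩ := hg j
  choose p hp using hh
  refine ⟨MvPolynomial.bind₁ p q, fun x => ?_⟩
  have h1 : Ctx.eqv (h x) = fun i => MvPolynomial.eval (Ctx.eqv x) (p i) :=
    funext fun i => hp i x
  rw [hq, h1]
  exact (MvPolynomial.eval₂Hom_bind₁ (RingHom.id ℝ) (Ctx.eqv x) p q).symm

theorem Dfn.sep {r : E → ℝ} {T : E → F → Prop} (hr : Poly r)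
    (hT : Dfn S (fun q : E × F => T q.1 q.2)) : Dfn S (fun e => Sep (r e) (T e)) := by
  have hr' : Poly (fun q : (E × F) × F => r q.1.1) := hr.comp Poly.id.fst.fst
  exact Dfn.all <| Dfn.all <| (hT.comp₂ Poly.id.fst.fst Poly.id.fst.snd).imp <|
    (hT.comp₂ Poly.id.fst.fst Poly.id.snd).imp <|
    (Dfn.near (hr'.add hr') Poly.id.fst.snd Poly.id.snd).imp
      (Dfn.eqv Poly.id.fst.snd Poly.id.snd)

theorem Dfn.cover {r : E → ℝ} {T T' : E → F → Prop} (hr : Poly r)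
    (hT : Dfn S (fun q : E × F => T q.1 q.2)) (hT' : Dfn S (fun q : E × F => T' q.1 q.2)) :
    Dfn S (fun e => Cover (r e) (T e) (T' e)) := by
  have hr' : Poly (fun q : (E × F) × F => r q.1.1) := hr.comp Poly.id.fst.fst
  exact Dfn.all <| hT.imp <| Dfn.ex <| (hT'.comp₂ Poly.id.fst.fst Poly.id.snd).and <|
    Dfn.near hr' Poly.id.fst.snd Poly.id.snd

theorem Dfn.match {T T' : E → F → Prop}
    (hT : Dfn S (fun q : E × F => T q.1 q.2)) (hT' : Dfn S (fun q : E × F => T' q.1 q.2)) :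
    Dfn S (fun e => Match (T e) (T' e)) := by
  have h1 : Dfn S (fun q : (E × ℝ) × F => T q.1.1 q.2) := hT.comp₂ Poly.id.fst.fst Poly.id.snd
  have h2 : Dfn S (fun q : (E × ℝ) × F => T' q.1.1 q.2) := hT'.comp₂ Poly.id.fst.fst Poly.id.snd
  refine Dfn.ex <| (Dfn.lt (Poly.const 0) Poly.id.snd).and <|
    Dfn.and (Dfn.and ?_ ?_) (Dfn.and ?_ ?_)
  · exact Dfn.sep (T := fun q : E × ℝ => T q.1) Poly.id.snd h1
  · exact Dfn.sep (T := fun q : E × ℝ => T' q.1) Poly.id.snd h2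
  · exact Dfn.cover (T := fun q : E × ℝ => T q.1) (T' := fun q : E × ℝ => T' q.1)
      Poly.id.snd h1 h2
  · exact Dfn.cover (T := fun q : E × ℝ => T' q.1) (T' := fun q : E × ℝ => T q.1)
      Poly.id.snd h2 h1

theorem Dfn.bin (r : ℝ) (k : Fin (Ctx.dim F) → ℤ) {x : E → F} (hx : Poly x) :
    Dfn S (fun e => Bin r k (x e)) :=
  Dfn.allFin fun i => (Dfn.lt (hx.coord i) (Poly.const _)).not.and
    (Dfn.lt (hx.coord i) (Poly.const _))

theorem Dfn.hasCode (r : ℝ) (c : Finset (Fin (Ctx.dim F) → ℤ)) {T : E → F → Prop}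
    (hT : Dfn S (fun q : E × F => T q.1 q.2)) : Dfn S (fun e => HasCode r c (T e)) :=
  (Dfn.sep (Poly.const r) hT).and <| Dfn.and
    (Dfn.all <| hT.imp <| Dfn.exFin fun k => Dfn.bin r k.1 Poly.id.snd)
    (Dfn.allFin fun k => Dfn.ex <| hT.and <| Dfn.bin r k.1 Poly.id.snd)

/-- `t` is bad if the fibre does not match with the nearby fibres. -/
def Bad (B : ℝ → F → Prop) (t : ℝ) : Prop :=
  ¬ ∃ ε : ℝ, 0 < ε ∧ ∀ t', (t' < t + ε ∧ t < t' + ε) → Match (B t) (B t')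

theorem Dfn.bad {B : E → ℝ → F → Prop}
    (hB : Dfn S (fun q : (E × ℝ) × F => B q.1.1 q.1.2 q.2)) :
    Dfn S (fun q : E × ℝ => Bad (B q.1) q.2) := by
  refine Dfn.not <| Dfn.ex <| (Dfn.lt (Poly.const 0) Poly.id.snd).and <| Dfn.all <|
    Dfn.imp (Dfn.and (Dfn.lt Poly.id.snd (Poly.id.fst.fst.snd.add Poly.id.fst.snd))
      (Dfn.lt Poly.id.fst.fst.snd (Poly.id.snd.add Poly.id.fst.snd))) ?_
  refine Dfn.match (T := fun q : ((E × ℝ) × ℝ) × ℝ => B q.1.1.1 q.1.1.2)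
    (T' := fun q : ((E × ℝ) × ℝ) × ℝ => B q.1.1.1 q.2) ?_ ?_
  · exact hB.comp ((Poly.id.fst.fst.fst).pair Poly.id.snd)
  · exact hB.comp (((Poly.id.fst.fst.fst.fst).pair Poly.id.fst.snd).pair Poly.id.snd)

theorem bad_finite {B : ℝ → F → Prop} (hB : Dfn S (fun q : ℝ × F => B q.1 q.2))
    (hfin : ∀ t, {x | B t x}.Finite) : {t | Bad B t}.Finite := by
  have hbad : Dfn S (fun t => Bad B t) :=
    (Dfn.bad (E := ℝ) (B := fun _ => B)
      (hB.comp₂ Poly.id.fst.snd Poly.id.snd)).comp₂ (A := fun _ t => Bad B t)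
      (Poly.const (0 : ℝ)) Poly.id
  rcases hbad.dichotomy with h | ⟨a, b, hab, hsub⟩
  · exact h
  exfalso
  let P : ℕ × Finset (Fin (Ctx.dim F) → ℤ) → ℝ → Prop := fun q t =>
    (a < t ∧ t < b) ∧ HasCode (1 / ((q.1 : ℝ) + 1)) q.2 (B t)
  have hP : ∀ q, Dfn S (P q) := fun q =>
    ((Dfn.lt (Poly.const a) Poly.id).and (Dfn.lt Poly.id (Poly.const b))).and
      (Dfn.hasCode _ _ hB)
  by_cases hall : ∀ q, {t | P q t}.Finite
  · have hc : (⋃ q, {t | P q t}).Countable := countable_iUnion fun q => (hall q).countable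
    have : Ioo a b ⊆ ⋃ q, {t | P q t} := by
      intro t ht
      obtain ⟨q, hq⟩ := exists_code (hfin t)
      exact mem_iUnion.2 ⟨q, ⟨ht.1, ht.2⟩, hq⟩
    exact absurd (hc.mono this) (Cardinal.Real.Ioo_countable_iff.not.2 (not_le.2 hab))
  push Not at hall
  obtain ⟨q, hq⟩ := hall
  rcases (hP q).dichotomy with h | ⟨a', b', hab', hsub'⟩
  · exact hq h
  have hmid : ∀ t', (a' < t' ∧ t' < b') → P q t' := fun t' ht' => hsub' ht'
  have hm := hmid ((a' + b') / 2) ⟨by linarith, by linarith⟩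
  have hbad' : Bad B ((a' + b') / 2) := hsub ⟨hm.1.1, hm.1.2⟩
  apply hbad'
  refine ⟨(b' - a') / 2, by linarith, fun t' ht' => ?_⟩
  have hm' := hmid t' ⟨by linarith [ht'.1, ht'.2], by linarith [ht'.1, ht'.2]⟩
  exact hm.2.match (by positivity) hm'.2

theorem ncard_const {B : ℝ → F → Prop} (hfin : ∀ t, {x | B t x}.Finite) {t e : ℝ}
    (h : ∀ s ∈ uIcc t e, ¬ Bad B s) : {x | B t x}.ncard = {x | B e x}.ncard := by
  refine isPreconnected_uIcc.constant (f := fun s => {x | B s x}.ncard) ?_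
    left_mem_uIcc right_mem_uIcc
  intro s hs
  apply ContinuousAt.continuousWithinAt
  have := h s hs
  unfold Bad at this
  rw [not_not] at this
  obtain ⟨ε, hε, hM⟩ := this
  refine (continuousAt_const (y := {x | B s x}.ncard)).congr ?_
  filter_upwards [Ioo_mem_nhds (show s - ε < s by linarith) (show s < s + ε by linarith)]
    with t' ht'
  exact (hM t' ⟨ht'.2, by linarith [ht'.1]⟩).ncard_eq (hfin _) (hfin _)

def Test (b : ℝ → Prop) (e : ℝ) : Prop :=
  (b e ∨ ∃ s, ∃ s', b s ∧ b s' ∧ e + e = s + s') ∨ (∃ s, b s ∧ (e = s + 1 ∨ s = e + 1)) ∨ e = 0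

theorem Test.finite {b : ℝ → Prop} (hb : {t | b t}.Finite) : {e | Test b e}.Finite := by
  have h1 : (Set.image2 (fun s s' : ℝ => (s + s') / 2) {t | b t} {t | b t}).Finite :=
    hb.image2 _ hb
  have h2 := hb.image (fun s => s + 1)
  have h3 := hb.image (fun s => s - 1)
  refine ((hb.union h1).union ((h2.union h3).union (finite_singleton (0 : ℝ)))).subset ?_
  rintro e ((h | ⟨s, s', hs, hs', h⟩) | ⟨s, hs, h | h⟩ | h)
  · exact Or.inl (Or.inl h)
  · exact Or.inl (Or.inr ⟨s, hs, s', hs', by simp only; linarith⟩)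
  · exact Or.inr (Or.inl (Or.inl ⟨s, hs, h.symm⟩))
  · exact Or.inr (Or.inl (Or.inr ⟨s, hs, by simp only; linarith⟩))
  · exact Or.inr (Or.inr h)

theorem exists_test {b : ℝ → Prop} (hb : {t | b t}.Finite) (t : ℝ) (ht : ¬ b t) :
    ∃ e, Test b e ∧ ∀ s ∈ uIcc t e, ¬ b s := by
  have hL : ({s | b s} ∩ Iio t).Finite := hb.inter_of_left _
  have hU : ({s | b s} ∩ Ioi t).Finite := hb.inter_of_left _
  have loc : ∀ e, (∀ s, b s → s < t → s < e) → (∀ s, b s → t < s → e < s) →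
      ∀ s ∈ uIcc t e, ¬ b s := by
    intro e h1 h2 s hs hbs
    rw [mem_uIcc] at hs
    rcases lt_trichotomy s t with h | rfl | h
    · have := h1 s hbs h
      rcases hs with hs | hs <;> linarith [hs.1, hs.2]
    · exact ht hbs
    · have := h2 s hbs h
      rcases hs with hs | hs <;> linarith [hs.1, hs.2]
  rcases ({s | b s} ∩ Iio t).eq_empty_or_nonempty with hl | hl <;>
  rcases ({s | b s} ∩ Ioi t).eq_empty_or_nonempty with hu | hu
  · refine ⟨0, Or.inr (Or.inr rfl), loc _ ?_ ?_⟩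
    · intro s h1 h2
      exact absurd (show s ∈ {s | b s} ∩ Iio t from ⟨h1, h2⟩) (by simp [hl])
    · intro s h1 h2
      exact absurd (show s ∈ {s | b s} ∩ Ioi t from ⟨h1, h2⟩) (by simp [hu])
  · obtain ⟨u, ⟨hu1, hu2⟩, hu3⟩ := hU.exists_minimal hu
    have hu3 : ∀ s, b s → t < s → u ≤ s := fun s h1 h2 => by
      rcases le_total u s with h | h
      · exact h
      · exact hu3 ⟨h1, h2⟩ h
    refine ⟨u - 1, Or.inr (Or.inl ⟨u, hu1, Or.inr (by ring)⟩), loc _ ?_ ?_⟩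
    · intro s h1 h2
      exact absurd (show s ∈ {s | b s} ∩ Iio t from ⟨h1, h2⟩) (by simp [hl])
    · intro s h1 h2
      linarith [hu3 s h1 h2]
  · obtain ⟨l, ⟨hl1, hl2⟩, hl3⟩ := hL.exists_maximal hl
    have hl3 : ∀ s, b s → s < t → s ≤ l := fun s h1 h2 => by
      rcases le_total s l with h | h
      · exact h
      · exact hl3 ⟨h1, h2⟩ h
    refine ⟨l + 1, Or.inr (Or.inl ⟨l, hl1, Or.inl rfl⟩), loc _ ?_ ?_⟩
    · intro s h1 h2
      linarith [hl3 s h1 h2]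
    · intro s h1 h2
      exact absurd (show s ∈ {s | b s} ∩ Ioi t from ⟨h1, h2⟩) (by simp [hu])
  · obtain ⟨u, ⟨hu1, hu2⟩, hu3⟩ := hU.exists_minimal hu
    have hu3 : ∀ s, b s → t < s → u ≤ s := fun s h1 h2 => by
      rcases le_total u s with h | h
      · exact h
      · exact hu3 ⟨h1, h2⟩ h
    obtain ⟨l, ⟨hl1, hl2⟩, hl3⟩ := hL.exists_maximal hl
    have hl3 : ∀ s, b s → s < t → s ≤ l := fun s h1 h2 => by
      rcases le_total s l with h | h
      · exact h
      · exact hl3 ⟨h1, h2⟩ h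
    have h5 : l < t := hl2
    have h6 : t < u := hu2
    refine ⟨(l + u) / 2, Or.inl (Or.inr ⟨l, u, hl1, hu1, by ring⟩), loc _ ?_ ?_⟩
    · intro s h1 h2
      linarith [hl3 s h1 h2]
    · intro s h1 h2
      linarith [hu3 s h1 h2]

theorem Dfn.test {b : E → ℝ → Prop} (hb : Dfn S (fun q : E × ℝ => b q.1 q.2)) :
    Dfn S (fun q : E × ℝ => Test (b q.1) q.2) := by
  refine Dfn.or (hb.or ?_) (Dfn.or ?_ (Dfn.eq Poly.id.snd (Poly.const 0)))
  · exact Dfn.ex <| Dfn.ex <| (hb.comp₂ Poly.id.fst.fst.fst Poly.id.fst.snd).and <|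
      (hb.comp₂ Poly.id.fst.fst.fst Poly.id.snd).and <|
      Dfn.eq (Poly.id.fst.fst.snd.add Poly.id.fst.fst.snd) (Poly.id.fst.snd.add Poly.id.snd)
  · exact Dfn.ex <| (hb.comp₂ Poly.id.fst.fst Poly.id.snd).and <|
      (Dfn.eq Poly.id.fst.snd (Poly.id.snd.add (Poly.const 1))).or
      (Dfn.eq Poly.id.snd (Poly.id.fst.snd.add (Poly.const 1)))

/-- Uniform finiteness. -/
theorem uniform_finiteness (S : OMinimalStructure) (m : ℕ) :
    ∀ (F : Type) [Ctx F] (A : (Fin m → ℝ) → F → Prop),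
      Dfn S (fun q : (Fin m → ℝ) × F => A q.1 q.2) → (∀ y, {x | A y x}.Finite) →
      ∃ K : ℕ, ∀ y, {x | A y x}.ncard ≤ K := by
  induction m with
  | zero =>
    intro F _ A _ _
    exact ⟨{x | A 0 x}.ncard, fun y => by rw [Subsingleton.elim y 0]⟩
  | succ m ih =>
    intro F _ A hA hfin
    let B : (Fin m → ℝ) → ℝ → F → Prop := fun y t x => A (Fin.cons t y) x
    have hB : Dfn S (fun q : ((Fin m → ℝ) × ℝ) × F => B q.1.1 q.1.2 q.2) :=
      hA.comp₂ (Poly.cons Poly.id.fst.snd Poly.id.fst.fst) Poly.id.snd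
    have hBfin : ∀ y t, {x | B y t x}.Finite := fun y t => hfin _
    have hbad : ∀ y, {t | Bad (B y) t}.Finite := fun y =>
      bad_finite (S := S) (hA.comp₂ (Poly.cons Poly.id.fst (Poly.const y)) Poly.id.snd)
        (hBfin y)
    have hT := Dfn.test (b := fun y => Bad (B y)) (Dfn.bad hB)
    have hfin' : ∀ y, {p : ℝ × F | Test (Bad (B y)) p.1 ∧ B y p.1 p.2}.Finite := by
      intro y
      refine ((Test.finite (hbad y)).biUnion
        (fun e _ => (hBfin y e).image (Prod.mk e))).subset ?_
      rintro ⟨e, x⟩ ⟨h1, h2⟩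
      exact mem_biUnion h1 ⟨x, h2, rfl⟩
    obtain ⟨K, hK⟩ := ih (ℝ × F) (fun y p => Test (Bad (B y)) p.1 ∧ B y p.1 p.2)
      ((hT.comp (Poly.id.fst.pair Poly.id.snd.fst)).and
        (hB.comp ((Poly.id.fst.pair Poly.id.snd.fst).pair Poly.id.snd.snd))) hfin'
    have hle : ∀ y e, Test (Bad (B y)) e → {x | B y e x}.ncard ≤ K := by
      intro y e he
      refine le_trans ?_ (hK y)
      exact Set.ncard_le_ncard_of_injOn (Prod.mk e) (fun x hx => ⟨he, hx⟩)
        (fun x _ x' _ h => (Prod.mk.inj h).2) (hfin' y)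
    refine ⟨K, fun y => ?_⟩
    have hy : {x | A y x} = {x | B (Fin.tail y) (y 0) x} := by
      simp only [B, Fin.cons_self_tail]
    rw [hy]
    by_cases hb : Bad (B (Fin.tail y)) (y 0)
    · exact hle _ _ (Or.inl (Or.inl hb))
    · obtain ⟨e, he, hs⟩ := exists_test (hbad (Fin.tail y)) (y 0) hb
      rw [ncard_const (hBfin _) hs]
      exact hle _ _ he

/-- Lexicographic order. -/
def LexLt {n : ℕ} (x y : Fin n → ℝ) : Prop := ∃ i, (∀ j : {j // j < i}, x j = y j) ∧ x i < y i

theorem lexLt_iff {n : ℕ} (x y : Fin n → ℝ) : LexLt x y ↔ toLex x < toLex y := by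
  constructor
  · rintro ⟨i, h1, h2⟩
    exact ⟨i, fun j hj => h1 ⟨j, hj⟩, h2⟩
  · rintro ⟨i, h1, h2⟩
    exact ⟨i, fun j => h1 j.1 j.2, h2⟩

theorem Dfn.lexLt {n : ℕ} {x y : E → Fin n → ℝ} (hx : Poly x) (hy : Poly y) :
    Dfn S (fun e => LexLt (x e) (y e)) :=
  Dfn.exFin fun i => (Dfn.allFin fun j : {j // j < i} => Dfn.eq (hx.app j.1) (hy.app j.1)).and
    (Dfn.lt (hx.app i) (hy.app i))

/-- Isolated points of the fibres of the relation `g`. -/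
def Iso {n : ℕ} (g : (Fin n → ℝ) → F → Prop) (x : Fin n → ℝ) (y : F) : Prop :=
  g x y ∧ ∃ ε : ℝ, 0 < ε ∧ ∀ x', g x' y → Near ε x x' → x' = x

theorem Dfn.iso {n : ℕ} {g : (Fin n → ℝ) → F → Prop}
    (hg : Dfn S (fun q : (Fin n → ℝ) × F => g q.1 q.2)) :
    Dfn S (fun q : (Fin n → ℝ) × F => Iso g q.1 q.2) :=
  hg.and <| Dfn.ex <| (Dfn.lt (Poly.const 0) Poly.id.snd).and <| Dfn.all <|
    (hg.comp₂ Poly.id.snd Poly.id.fst.fst.snd).imp <|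
    (Dfn.near Poly.id.fst.snd Poly.id.fst.fst.fst Poly.id.snd).imp
    (Dfn.eqv Poly.id.snd Poly.id.fst.fst.fst)

theorem near_iff {n : ℕ} {x x' : Fin n → ℝ} {ε : ℝ} (hε : 0 < ε) :
    Near ε x x' ↔ dist x' x < ε := by
  rw [dist_pi_lt_iff hε]
  refine forall_congr' fun i => ?_
  change (x i < x' i + ε ∧ x' i < x i + ε) ↔ _
  rw [Real.dist_eq, abs_lt]
  constructor <;> rintro ⟨h1, h2⟩ <;> constructor <;> linarith

theorem iso_finite {n : ℕ} {g : (Fin n → ℝ) → F → Prop}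
    (hg : Dfn S (fun q : (Fin n → ℝ) × F => g q.1 q.2)) (y : F) : {x | Iso g x y}.Finite := by
  have hc : {x | Iso g x y}.Countable := by
    have hd : DiscreteTopology {x | Iso g x y} := by
      rw [discreteTopology_iff_isOpen_singleton]
      rintro ⟨x, hx⟩
      obtain ⟨-, ε, hε, hx2⟩ := hx
      rw [Metric.isOpen_iff]
      rintro ⟨z, hz⟩ hzx
      obtain rfl : z = x := congrArg Subtype.val hzx
      refine ⟨ε, hε, ?_⟩
      rintro ⟨x', hx'⟩ hxx'
      refine Subtype.ext (hx2 x' hx'.1 ((near_iff hε).2 hxx'))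
    exact countable_coe_iff.1 (TopologicalSpace.separableSpace_iff_countable.1 inferInstance)
  have hi := Dfn.iso hg
  have hfin : ∀ i : Fin n, {t | ∃ x, Iso g x y ∧ t = x i}.Finite := by
    intro i
    refine Dfn.finite_of_countable (S := S)
      (Dfn.ex <| (hi.comp₂ Poly.id.snd (Poly.const y)).and <|
        Dfn.eq Poly.id.fst (Poly.id.snd.app i)) ?_
    refine (hc.image (fun x => x i)).mono ?_
    rintro t ⟨x, hx, rfl⟩
    exact ⟨x, hx, rfl⟩
  refine (Set.Finite.pi fun i => hfin i).subset ?_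
  intro x hx i _
  exact ⟨x, hx, rfl⟩

/-- Points of `D` with at least `k` lexicographically smaller points in the same fibre. -/
def Lev {n : ℕ} (g : (Fin n → ℝ) → F → Prop) : ℕ → (Fin n → ℝ) → F → Prop
  | 0 => g
  | k + 1 => fun x y => g x y ∧ ∃ x', Lev g k x' y ∧ LexLt x' x

theorem Dfn.lev {n : ℕ} {g : (Fin n → ℝ) → F → Prop}
    (hg : Dfn S (fun q : (Fin n → ℝ) × F => g q.1 q.2)) (k : ℕ) :
    Dfn S (fun q : (Fin n → ℝ) × F => Lev g k q.1 q.2) := by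
  induction k with
  | zero => exact hg
  | succ k ih =>
    exact hg.and <| Dfn.ex <| (ih.comp₂ Poly.id.snd Poly.id.fst.snd).and <|
      Dfn.lexLt Poly.id.snd Poly.id.fst.fst

theorem Lev.base {n : ℕ} {g : (Fin n → ℝ) → F → Prop} {k : ℕ} {x : Fin n → ℝ} {y : F}
    (h : Lev g k x y) : g x y := by
  cases k with
  | zero => exact h
  | succ k => exact h.1

theorem Lev.card {n : ℕ} {g : (Fin n → ℝ) → F → Prop} {k : ℕ} {x : Fin n → ℝ} {y : F}
    (h : Lev g k x y) : ∃ s : Finset (Fin n → ℝ), s.card = k + 1 ∧ (∀ z ∈ s, g z y) ∧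
      ∀ z ∈ s, toLex z ≤ toLex x := by
  classical
  induction k generalizing x with
  | zero => exact ⟨{x}, by simp, fun z hz => by rw [Finset.mem_singleton.1 hz]; exact h, by simp⟩
  | succ k ih =>
    obtain ⟨h1, x', h2, h3⟩ := h
    rw [lexLt_iff] at h3
    obtain ⟨s, hs1, hs2, hs3⟩ := ih h2
    refine ⟨insert x s, ?_, ?_, ?_⟩
    · rw [Finset.card_insert_of_notMem, hs1]
      intro hx
      exact absurd (hs3 x hx) (not_le.2 h3)
    · intro z hz
      rcases Finset.mem_insert.1 hz with rfl | hz
      · exact h1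
      · exact hs2 z hz
    · intro z hz
      rcases Finset.mem_insert.1 hz with rfl | hz
      · exact le_rfl
      · exact (hs3 z hz).trans h3.le

end OMin

open OMin
/-- Let `f : X → ℝ^m` be a function definable in an o-minimal structure with definable
domain `X ⊂ ℝⁿ`. Then there exist definable sets `X₀, X₁, …, X_M` with
`X = X₀ ∪ X₁ ∪ ⋯ ∪ X_M` such that `f` restricted to each of `X₁, …, X_M` is injective
and the fibers of `f` restricted to `X₀` contain no isolated points. -/
theorem stmt_17 (S : OMinimalStructure) {n m : ℕ}
    (X : Set (Fin n → ℝ)) (hX : X ∈ S.sets n)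
    (f : (Fin n → ℝ) → (Fin m → ℝ)) (hf : functionGraph X f ∈ S.sets (n + m)) :
    ∃ (M : ℕ) (Xs : ℕ → Set (Fin n → ℝ)),
      (∀ k ≤ M, Xs k ∈ S.sets n) ∧
      X = ⋃ k ∈ Set.Iic M, Xs k ∧
      (∀ k, 1 ≤ k → k ≤ M → Set.InjOn f (Xs k)) ∧
      (∀ (y : Fin m → ℝ), ∀ x ∈ Xs 0, f x = y →
        x ∈ closure ({x' ∈ Xs 0 | f x' = y} \ {x})) := by
  let g : (Fin n → ℝ) → (Fin m → ℝ) → Prop := fun x y => x ∈ X ∧ y = f x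
  have hg : Dfn S (fun q : (Fin n → ℝ) × (Fin m → ℝ) => g q.1 q.2) := hf
  have hD := Dfn.iso hg
  have hDfin : ∀ y, {x | Iso g x y}.Finite := iso_finite hg
  obtain ⟨K, hK⟩ := uniform_finiteness S m (Fin n → ℝ) (fun y x => Iso g x y)
    (hD.comp₂ (A := fun x y => Iso g x y) Poly.id.snd Poly.id.fst) hDfin
  have hLK : ∀ x y, ¬ Lev (Iso g) K x y := by
    intro x y h
    obtain ⟨s, hs1, hs2, -⟩ := h.card
    have h1 : (↑s : Set (Fin n → ℝ)) ⊆ {x | Iso g x y} := fun z hz => hs2 z hz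
    have h2 := Set.ncard_le_ncard h1 (hDfin y)
    rw [Set.ncard_coe_finset] at h2
    have := hK y
    omega
  let Xs : ℕ → Set (Fin n → ℝ) := fun k => match k with
    | 0 => {x | x ∈ X ∧ ¬ ∃ y, Iso g x y}
    | k + 1 => {x | ∃ y, Lev (Iso g) k x y ∧ ¬ Lev (Iso g) (k + 1) x y}
  have hfy : ∀ {x y}, Iso g x y → x ∈ X ∧ y = f x := fun h => h.1
  refine ⟨K, Xs, ?_, ?_, ?_, ?_⟩
  · intro k _
    have hXd : Dfn S (fun x : Fin n → ℝ => x ∈ X) := hX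
    cases k with
    | zero => exact hXd.and (Dfn.ex hD).not
    | succ k =>
      exact Dfn.ex (P := fun x y => Lev (Iso g) k x y ∧ ¬ Lev (Iso g) (k + 1) x y)
        ((Dfn.lev hD k).and (Dfn.lev hD (k + 1)).not)
  · ext x
    simp only [mem_iUnion, exists_prop, Set.mem_Iic]
    constructor
    · intro hx
      by_cases h : ∃ y, Iso g x y
      · obtain ⟨y, hy⟩ := h
        by_contra hcon
        have : ∀ k ≤ K, Lev (Iso g) k x y := by
          intro k
          induction k with
          | zero => exact fun _ => hy
          | succ k ih =>
            intro hk
            by_contra hnot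
            exact hcon ⟨k + 1, hk, y, ih (by omega), hnot⟩
        exact hLK x y (this K le_rfl)
      · exact ⟨0, Nat.zero_le _, hx, h⟩
    · rintro ⟨k, -, hk⟩
      cases k with
      | zero => exact hk.1
      | succ k =>
        obtain ⟨y, hy, -⟩ := hk
        exact (hfy hy.base).1
  · intro k hk1 _
    obtain ⟨k, rfl⟩ : ∃ j, k = j + 1 := ⟨k - 1, by omega⟩
    have key : ∀ x ∈ Xs (k + 1), ∀ x' ∈ Xs (k + 1), f x = f x' → ¬ toLex x < toLex x' := by
      rintro x ⟨y, hy, -⟩ x' ⟨y', hy', hn'⟩ he hlt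
      have hyy : y = y' := by rw [(hfy hy.base).2, (hfy hy'.base).2, he]
      subst hyy
      exact hn' ⟨hy'.base, x, hy, (lexLt_iff _ _).2 hlt⟩
    intro x hx x' hx' he
    rcases lt_trichotomy (toLex x) (toLex x') with h | h | h
    · exact absurd h (key x hx x' hx' he)
    · exact toLex.injective h
    · exact absurd h (key x' hx' x hx he.symm)
  · rintro y x ⟨hxX, hxn⟩ hxy
    have hcl : x ∈ closure ({x' | g x' y} \ {x}) := by
      rw [Metric.mem_closure_iff]
      intro ε hε
      by_contra hcon
      apply hxn
      refine ⟨y, ⟨hxX, hxy.symm⟩, ε, hε, fun x' hx' hnear => ?_⟩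
      by_contra hne
      rw [near_iff hε, dist_comm] at hnear
      exact hcon ⟨x', ⟨hx', hne⟩, hnear⟩
    have hsub : {x' | g x' y} \ {x} ⊆
        ({x' ∈ Xs 0 | f x' = y} \ {x}) ∪ {x' | Iso g x' y} := by
      rintro z ⟨hz, hzx⟩
      by_cases h : Iso g z y
      · exact Or.inr h
      · refine Or.inl ⟨⟨⟨hz.1, ?_⟩, hz.2.symm⟩, hzx⟩
        rintro ⟨y', hy'⟩
        have : y' = y := by rw [(hfy hy').2, hz.2]
        exact h (this ▸ hy')
    have h2 := closure_mono hsub hcl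
    rw [closure_union, (hDfin y).isClosed.closure_eq] at h2
    rcases h2 with h2 | h2
    · exact h2
    · exact absurd ⟨y, h2⟩ hxn
end

section
/- Let 𝔖 be an o-minimal structure, X ⊂ ℝⁿ definable in 𝔖, and f: X → ℝ^m definable with all fibers finite. Then there is a uniform bound c such that every fiber of f has at most c elements, and X can be written as a union of at most c definable sets on each of which f is injective. -/
open Set

open Set

/-- A predicate on `ℝ^ι` definable in `S`, for an arbitrary index type. -/
def Dd (S : OMinimalStructure) (ι : Type) (P : (ι → ℝ) → Prop) : Prop :=
  ∃ (k : ℕ) (s : Set (Fin k → ℝ)) (_ : s ∈ S.sets k) (σ : Fin k → ι),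
    ∀ v, P v ↔ (fun i => v (σ i)) ∈ s

namespace OMinimalStructure

variable (S : OMinimalStructure)

theorem univ_mem (n : ℕ) : (univ : Set (Fin n → ℝ)) ∈ S.sets n := by
  have h := S.semialgebraic_mem (IsSemialgebraic.eq (0 : MvPolynomial (Fin n) ℝ))
  simpa using h

theorem forall_mem {n : ℕ} {α : Type} (F : Finset α) (s : α → Set (Fin n → ℝ))
    (h : ∀ a, s a ∈ S.sets n) : {x | ∀ a ∈ F, x ∈ s a} ∈ S.sets n := by
  classical
  induction F using Finset.induction_on with
  | empty => simpa using S.univ_mem n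
  | insert a F _ ih =>
    have := S.inter_mem (h a) ih
    convert this using 1
    ext x
    simp

theorem reindex {n k : ℕ} {s : Set (Fin k → ℝ)} (hs : s ∈ S.sets k) (σ : Fin k → Fin n) :
    {x : Fin n → ℝ | (fun i => x (σ i)) ∈ s} ∈ S.sets n := by
  have h1 := S.prod_mem (S.univ_mem n) hs
  have h2 := S.forall_mem (n := n + k) (Finset.univ : Finset (Fin k))
    (fun i => {z | MvPolynomial.eval z
      (MvPolynomial.X (Fin.natAdd n i) - MvPolynomial.X (Fin.castAdd k (σ i)) :
        MvPolynomial (Fin (n + k)) ℝ) = 0})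
    (fun i => S.semialgebraic_mem (IsSemialgebraic.eq _))
  have h3 := S.proj_mem (S.inter_mem h1 h2)
  convert h3 using 1
  ext x
  constructor
  · intro hx
    refine ⟨Fin.append x (fun i => x (σ i)), ⟨⟨mem_univ _, ?_⟩, ?_⟩, ?_⟩
    · simpa using hx
    · simp
    · simp
  · rintro ⟨z, ⟨⟨_, hz⟩, hz2⟩, rfl⟩
    have : (fun i => z (Fin.castAdd k (σ i))) = fun j => z (Fin.natAdd n j) := by
      funext i
      have := hz2 i (Finset.mem_univ _)
      simp only [mem_ofPred_eq, map_sub, MvPolynomial.eval_X] at this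
      linarith
    simpa [this] using hz

end OMinimalStructure

namespace Dd

variable {S : OMinimalStructure} {ι κ : Type}

theorem mem {n : ℕ} {P : (Fin n → ℝ) → Prop} (h : Dd S (Fin n) P) : {x | P x} ∈ S.sets n := by
  obtain ⟨k, s, hs, σ, h⟩ := h
  convert S.reindex hs σ using 1
  ext x
  exact h x

theorem of_mem {n : ℕ} {s : Set (Fin n → ℝ)} (hs : s ∈ S.sets n) (σ : Fin n → ι) :
    Dd S ι (fun v => (fun i => v (σ i)) ∈ s) := ⟨n, s, hs, σ, fun _ => Iff.rfl⟩

theorem congr {P Q : (ι → ℝ) → Prop} (h : Dd S ι P) (e : ∀ v, Q v ↔ P v) : Dd S ι Q := by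
  obtain ⟨k, s, hs, σ, h⟩ := h
  exact ⟨k, s, hs, σ, fun v => (e v).trans (h v)⟩

theorem comp {P : (κ → ℝ) → Prop} (h : Dd S κ P) (τ : κ → ι) :
    Dd S ι (fun v => P (fun i => v (τ i))) := by
  obtain ⟨k, s, hs, σ, h⟩ := h
  exact ⟨k, s, hs, fun i => τ (σ i), fun v => h _⟩

theorem not {P : (ι → ℝ) → Prop} (h : Dd S ι P) : Dd S ι (fun v => ¬ P v) := by
  obtain ⟨k, s, hs, σ, h⟩ := h
  exact ⟨k, sᶜ, S.compl_mem hs, σ, fun v => not_congr (h v)⟩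

theorem and {P Q : (ι → ℝ) → Prop} (hP : Dd S ι P) (hQ : Dd S ι Q) :
    Dd S ι (fun v => P v ∧ Q v) := by
  obtain ⟨k, s, hs, σ, h⟩ := hP
  obtain ⟨l, t, ht, τ, h'⟩ := hQ
  refine ⟨k + l, _, S.prod_mem hs ht, Fin.append σ τ, fun v => ?_⟩
  simp [h, h']

theorem or {P Q : (ι → ℝ) → Prop} (hP : Dd S ι P) (hQ : Dd S ι Q) :
    Dd S ι (fun v => P v ∨ Q v) :=
  (hP.not.and hQ.not).not.congr (fun v => by tauto)

theorem imp {P Q : (ι → ℝ) → Prop} (hP : Dd S ι P) (hQ : Dd S ι Q) :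
    Dd S ι (fun v => P v → Q v) :=
  (hP.and hQ.not).not.congr (fun v => by tauto)

theorem exv [Fintype ι] [Fintype κ] {P : (ι → ℝ) → (κ → ℝ) → Prop}
    (h : Dd S (ι ⊕ κ) (fun w => P (fun i => w (Sum.inl i)) (fun j => w (Sum.inr j)))) :
    Dd S ι (fun v => ∃ y, P v y) := by
  let e := Fintype.equivFin ι
  let e' := Fintype.equivFin κ
  have h1 := (h.comp (Sum.elim (fun i => Fin.castAdd (Fintype.card κ) (e i))
    (fun j => Fin.natAdd (Fintype.card ι) (e' j)))).mem
  refine ⟨_, _, S.proj_mem h1, e.symm, fun v => ?_⟩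
  constructor
  · rintro ⟨y, hy⟩
    refine ⟨Fin.append (fun i => v (e.symm i)) (fun j => y (e'.symm j)), ?_, ?_⟩
    · simpa using hy
    · simp
  · rintro ⟨z, hz, hv⟩
    refine ⟨fun j => z (Fin.natAdd _ (e' j)), ?_⟩
    have : v = fun i => z (Fin.castAdd _ (e i)) := by
      funext i
      simpa using congrFun hv (e i)
    rw [this]
    exact hz

theorem ex [Fintype ι] {P : (ι → ℝ) → ℝ → Prop}
    (h : Dd S (Option ι) (fun w => P (fun i => w (some i)) (w none))) :
    Dd S ι (fun v => ∃ t, P v t) := by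
  have h1 := h.comp (ι := ι ⊕ Unit) (fun o => o.elim (Sum.inr ()) Sum.inl)
  have := exv (P := fun v (y : Unit → ℝ) => P v (y ())) h1
  refine this.congr fun v => ⟨fun ⟨t, ht⟩ => ⟨fun _ => t, ht⟩, fun ⟨y, hy⟩ => ⟨_, hy⟩⟩

theorem all [Fintype ι] {P : (ι → ℝ) → ℝ → Prop}
    (h : Dd S (Option ι) (fun w => P (fun i => w (some i)) (w none))) :
    Dd S ι (fun v => ∀ t, P v t) :=
  (ex (P := fun v t => ¬ P v t) h.not).not.congr (fun v => by simp)

theorem pos [Fintype ι] (p : MvPolynomial ι ℝ) :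
    Dd S ι (fun v => 0 < MvPolynomial.eval v p) := by
  let e := Fintype.equivFin ι
  refine ⟨_, _, S.semialgebraic_mem (IsSemialgebraic.lt (MvPolynomial.rename e p)), e.symm,
    fun v => ?_⟩
  simp only [mem_ofPred_eq, MvPolynomial.eval_rename]
  have : (fun i => v (e.symm i)) ∘ e = v := by
    funext i
    simp
  rw [this]

theorem lt [Fintype ι] (p q : MvPolynomial ι ℝ) :
    Dd S ι (fun v => MvPolynomial.eval v p < MvPolynomial.eval v q) :=
  (pos (q - p)).congr (fun v => by simp)

theorem eq [Fintype ι] (p q : MvPolynomial ι ℝ) :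
    Dd S ι (fun v => MvPolynomial.eval v p = MvPolynomial.eval v q) :=
  ((lt p q).or (lt q p)).not.congr (fun v => by
    rw [← ne_iff_lt_or_gt, not_not])

theorem forall_fin [Fintype ι] {α : Type} [Finite α] {P : α → (ι → ℝ) → Prop}
    (h : ∀ a, Dd S ι (P a)) : Dd S ι (fun v => ∀ a, P a v) := by
  classical
  have := Fintype.ofFinite α
  have key : ∀ F : Finset α, Dd S ι (fun v => ∀ a ∈ F, P a v) := by
    intro F
    induction F using Finset.induction_on with
    | empty => exact (eq (0 : MvPolynomial ι ℝ) 0).congr (fun v => by simp)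
    | insert a F _ ih => exact ((h a).and ih).congr (fun v => by simp)
  exact (key Finset.univ).congr (fun v => by simp)

theorem exists_fin [Fintype ι] {α : Type} [Finite α] {P : α → (ι → ℝ) → Prop}
    (h : ∀ a, Dd S ι (P a)) : Dd S ι (fun v => ∃ a, P a v) :=
  (forall_fin (fun a => (h a).not)).not.congr (fun v => by simp)

/-- Fixing parameters. -/
theorem fix [Fintype ι] [Fintype κ] {P : (ι → ℝ) → (κ → ℝ) → Prop}
    (h : Dd S (ι ⊕ κ) (fun w => P (fun i => w (Sum.inl i)) (fun j => w (Sum.inr j))))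
    (x : κ → ℝ) : Dd S ι (fun v => P v x) := by
  have h2 : Dd S (ι ⊕ κ) (fun w => ∀ j : κ, w (Sum.inr j) = x j) :=
    forall_fin (fun j => (eq (MvPolynomial.X (Sum.inr j)) (MvPolynomial.C (x j))).congr
      (fun v => by simp))
  refine (exv (P := fun v y => P v y ∧ ∀ j, y j = x j) (h.and h2)).congr fun v => ?_
  constructor
  · intro hv
    exact ⟨x, hv, fun _ => rfl⟩
  · rintro ⟨y, hy, hj⟩
    rwa [← funext hj]

end Dd

section oneDim

variable {S : OMinimalStructure}

theorem omin_struct {T : Set ℝ} (h : Dd S (Fin 1) (fun w => w 0 ∈ T)) :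
    (T \ interior T).Finite ∧ (T.Countable → T.Finite) := by
  obtain ⟨F, I, hI, hT⟩ := S.o_minimal h.mem
  have hT' : T = ↑F ∪ ⋃₀ ↑I := by
    rw [← hT]
    ext t
    constructor
    · intro ht
      exact ⟨fun _ => t, ht, rfl⟩
    · rintro ⟨w, hw, rfl⟩
      exact hw
  have hopen : ∀ J ∈ I, IsOpen J := by
    intro J hJ
    obtain ⟨a, b, rfl | rfl | rfl | rfl⟩ := hI J hJ
    · exact isOpen_Ioo
    · exact isOpen_Ioi
    · exact isOpen_Iio
    · exact isOpen_univ
  have hU : IsOpen (⋃₀ (I : Set (Set ℝ))) := isOpen_sUnion hopen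
  constructor
  · refine F.finite_toSet.subset ?_
    rintro t ⟨ht, hti⟩
    rw [hT'] at ht
    rcases ht with ht | ht
    · exact ht
    · exact absurd (mem_interior.2 ⟨_, by rw [hT']; exact subset_union_right, hU, ht⟩) hti
  · intro hc
    have hUe : ⋃₀ (I : Set (Set ℝ)) = ∅ := by
      by_contra hne
      have hne' := nonempty_iff_ne_empty.2 hne
      have hcU : (⋃₀ (I : Set (Set ℝ))).Countable :=
        hc.mono (by rw [hT']; exact subset_union_right)
      have := hcU.dense_compl ℝ
      obtain ⟨x, hx, hx'⟩ := this.inter_open_nonempty _ hU hne'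
      exact hx' hx
    rw [hT', hUe, union_empty]
    exact F.finite_toSet

end oneDim

/-- `|a - b| < d` in polynomial form. -/
def Near (d a b : ℝ) : Prop := a - b < d ∧ b - a < d

theorem Dd.near {S : OMinimalStructure} {ι : Type} [Fintype ι] (i j k : ι) :
    Dd S ι (fun w => Near (w i) (w j) (w k)) :=
  ((Dd.lt (MvPolynomial.X j - MvPolynomial.X k) (MvPolynomial.X i)).and
    (Dd.lt (MvPolynomial.X k - MvPolynomial.X j) (MvPolynomial.X i))).congr
      (fun v => by simp [Near])

theorem Dd.eqv {S : OMinimalStructure} {ι : Type} [Fintype ι] (i j : ι) :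
    Dd S ι (fun w => w i = w j) :=
  (Dd.eq (MvPolynomial.X i) (MvPolynomial.X j)).congr (fun v => by simp)

theorem Dd.ltv {S : OMinimalStructure} {ι : Type} [Fintype ι] (i j : ι) :
    Dd S ι (fun w => w i < w j) :=
  (Dd.lt (MvPolynomial.X i) (MvPolynomial.X j)).congr (fun v => by simp)

theorem Dd.posv {S : OMinimalStructure} {ι : Type} [Fintype ι] (i : ι) :
    Dd S ι (fun w => 0 < w i) :=
  (Dd.pos (MvPolynomial.X i)).congr (fun v => by simp)

/-- `t` is good for the family `B`: nearby fibers are in definable bijection with `B t`. -/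
def GoodAt (B : ℝ → ℝ → Prop) (t : ℝ) : Prop :=
  ∃ δ, ∃ ε, 0 < δ ∧ 0 < ε ∧ ∀ s, Near ε s t →
    ((∀ b, B t b → ∃ b', B s b' ∧ Near δ b b') ∧
    (∀ b', B s b' → ∃ b, B t b ∧ Near δ b b') ∧
    (∀ b, ∀ b', ∀ b'', B t b → B s b' → B s b'' → Near δ b b' → Near δ b b'' → b' = b'') ∧
    (∀ b, ∀ b', ∀ c, B t b → B t b' → B s c → Near δ b c → Near δ b' c → b = b'))

theorem Dd.goodAt {S : OMinimalStructure} {ι : Type} {B : (ι → ℝ) → ℝ → ℝ → Prop}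
    (hB : ∀ (κ : Type) [Fintype κ] (f : ι → κ) (i j : κ),
      Dd S κ (fun w => B (fun a => w (f a)) (w i) (w j)))
    (κ : Type) [Fintype κ] (f : ι → κ) (i : κ) :
      Dd S κ (fun w => GoodAt (B (fun a => w (f a))) (w i)) := by
  unfold GoodAt
  refine Dd.ex (Dd.ex ((Dd.posv _).and ((Dd.posv _).and (Dd.all ((Dd.near _ _ _).imp
    (Dd.and ?_ (Dd.and ?_ (Dd.and ?_ ?_))))))))
  · exact Dd.all ((hB _ _ _ _).imp (Dd.ex ((hB _ _ _ _).and (Dd.near _ _ _))))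
  · exact Dd.all ((hB _ _ _ _).imp (Dd.ex ((hB _ _ _ _).and (Dd.near _ _ _))))
  · exact Dd.all (Dd.all (Dd.all ((hB _ _ _ _).imp ((hB _ _ _ _).imp ((hB _ _ _ _).imp
      ((Dd.near _ _ _).imp ((Dd.near _ _ _).imp (Dd.eqv _ _))))))))
  · exact Dd.all (Dd.all (Dd.all ((hB _ _ _ _).imp ((hB _ _ _ _).imp ((hB _ _ _ _).imp
      ((Dd.near _ _ _).imp ((Dd.near _ _ _).imp (Dd.eqv _ _))))))))

theorem GoodAt.eventually {B : ℝ → ℝ → Prop} {t : ℝ} (h : GoodAt B t) :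
    ∀ᶠ s in nhds t, {b | B s b}.ncard = {b | B t b}.ncard := by
  obtain ⟨δ, ε, hδ, hε, h⟩ := h
  filter_upwards [Metric.ball_mem_nhds t hε] with s hs
  rw [Metric.mem_ball, Real.dist_eq, abs_lt] at hs
  obtain ⟨h1, h2, h3, h4⟩ := h s ⟨by linarith, by linarith⟩
  choose! g hg hg' using h1
  symm
  refine Set.ncard_congr (fun a _ => g a) (fun a ha => hg a ha) ?_ ?_
  · intro a b ha hb hab
    have hab' : g a = g b := hab
    have hb2 := hg' b hb
    rw [← hab'] at hb2
    exact h4 a b (g a) ha hb (hg a ha) (hg' a ha) hb2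
  · intro b hb
    obtain ⟨a, ha, hab⟩ := h2 b hb
    exact ⟨a, ha, h3 a _ _ ha (hg a ha) hb (hg' a ha) hab⟩

theorem ncard_const {B : ℝ → ℝ → Prop} {t t' : ℝ} (h : ∀ u ∈ uIcc t t', GoodAt B u) :
    {b | B t b}.ncard = {b | B t' b}.ncard := by
  have hc : ContinuousOn (fun t => {b | B t b}.ncard) (uIcc t t') := by
    intro u hu
    apply ContinuousAt.continuousWithinAt
    exact (continuousAt_const (y := {b | B u b}.ncard)).congr
      ((h u hu).eventually.mono fun s hs => hs.symm)
  exact isPreconnected_uIcc.constant hc left_mem_uIcc right_mem_uIcc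

theorem le_ncard_iff {s : Set ℝ} (hs : s.Finite) (k : ℕ) :
    k ≤ s.ncard ↔ ∃ u : Fin k → ℝ, (∀ i j, i ≠ j → ¬ u i = u j) ∧ ∀ i, u i ∈ s := by
  constructor
  · intro h
    obtain ⟨t, hts, htc⟩ := Set.exists_subset_card_eq h
    have htf : t.Finite := hs.subset hts
    rw [Set.ncard_eq_toFinset_card t htf] at htc
    let e := Finset.equivFinOfCardEq htc
    refine ⟨fun i => (e.symm i : ℝ), ?_, ?_⟩
    · intro i j hij h
      exact hij (e.symm.injective (Subtype.ext h))
    · intro i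
      exact hts (htf.mem_toFinset.1 (e.symm i).2)
  · rintro ⟨u, hu, hus⟩
    have hinj : Function.Injective u := fun i j h => by
      by_contra hne
      exact hu i j hne h
    have h1 : (range u).ncard = k := by
      rw [← image_univ, Set.ncard_image_of_injective _ hinj]
      simp
    rw [← h1]
    exact Set.ncard_le_ncard (range_subset_iff.2 hus) hs

theorem planar {S : OMinimalStructure} {B : ℝ → ℝ → Prop}
    (hB : ∀ (κ : Type) [Fintype κ] (i j : κ), Dd S κ (fun w => B (w i) (w j)))
    (hfin : ∀ t, {b | B t b}.Finite) : {t | ¬ GoodAt B t}.Finite := by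
  have hgood : Dd S (Fin 1) (fun w => w 0 ∈ {t | ¬ GoodAt B t}) :=
    (Dd.goodAt (ι := Empty) (B := fun _ => B) (fun κ _ _ i j => hB κ i j)
      (Fin 1) Empty.elim 0).not
  have hE : ∀ k : ℕ, Dd S (Fin 1) (fun w => k ≤ {b | B (w 0) b}.ncard) := by
    intro k
    have : Dd S (Fin 1) (fun w => ∃ u : Fin k → ℝ,
        (∀ i j, i ≠ j → ¬ u i = u j) ∧ ∀ i, B (w 0) (u i)) := by
      refine Dd.exv (Dd.and (Dd.forall_fin fun i => Dd.forall_fin fun j => ?_)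
        (Dd.forall_fin fun i => hB _ _ _))
      by_cases hij : i = j
      · exact (Dd.eq (0 : MvPolynomial _ ℝ) 0).congr (fun v => by simp [hij])
      · exact (Dd.eqv (Sum.inr i) (Sum.inr j)).not.congr (fun v => by simp [hij])
    exact this.congr fun v => le_ncard_iff (hfin _) k
  have hN : ∀ k : ℕ, Dd S (Fin 1) (fun w => w 0 ∈ {t | {b | B t b}.ncard = k}) := by
    intro k
    refine ((hE k).and (hE (k + 1)).not).congr fun v => ?_
    simp only [mem_ofPred_eq]
    omega
  have hP : ∀ q : ℚ × ℚ, Dd S (Fin 1)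
      (fun w => w 0 ∈ {t | ∃ b, ((q.1 : ℝ) < b ∧ b < (q.2 : ℝ)) ∧ B t b}) := by
    intro q
    refine Dd.ex (Dd.and (Dd.and ?_ ?_) (hB _ _ _))
    · exact (Dd.lt (MvPolynomial.C (q.1 : ℝ)) (MvPolynomial.X none)).congr (fun v => by simp)
    · exact (Dd.lt (MvPolynomial.X none) (MvPolynomial.C (q.2 : ℝ))).congr (fun v => by simp)
  refine (omin_struct hgood).2 ?_
  refine Set.Countable.mono (s₂ := (⋃ k : ℕ, ({t | {b | B t b}.ncard = k} \
      interior {t | {b | B t b}.ncard = k})) ∪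
    ⋃ q : ℚ × ℚ, ({t | ∃ b, ((q.1 : ℝ) < b ∧ b < (q.2 : ℝ)) ∧ B t b} \
      interior {t | ∃ b, ((q.1 : ℝ) < b ∧ b < (q.2 : ℝ)) ∧ B t b})) ?_
    ((countable_iUnion fun k => (omin_struct (hN k)).1.countable).union
      (countable_iUnion fun q => (omin_struct (hP q)).1.countable))
  intro t ht
  by_contra hex
  apply ht
  rw [mem_union, not_or] at hex
  obtain ⟨hex1, hex2⟩ := hex
  have h1 : ∀ᶠ s in nhds t, {b | B s b}.ncard = {b | B t b}.ncard := by
    by_contra hcon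
    refine hex1 (mem_iUnion.2 ⟨{b | B t b}.ncard, rfl, fun h => hcon ?_⟩)
    exact mem_interior_iff_mem_nhds.1 h
  have h2 : ∀ q : ℚ × ℚ, (∃ b, ((q.1 : ℝ) < b ∧ b < (q.2 : ℝ)) ∧ B t b) →
      ∀ᶠ s in nhds t, ∃ b, ((q.1 : ℝ) < b ∧ b < (q.2 : ℝ)) ∧ B s b := by
    intro q hq
    by_contra hcon
    refine hex2 (mem_iUnion.2 ⟨q, hq, fun h => hcon ?_⟩)
    exact mem_interior_iff_mem_nhds.1 h
  -- separation
  obtain ⟨δ, hδ, hsep⟩ : ∃ δ > 0, ∀ b b', B t b → B t b' → |b - b'| < 2 * δ → b = b' := by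
    have hf2 : ((fun p : ℝ × ℝ => |p.1 - p.2|) '' {p | (B t p.1 ∧ B t p.2) ∧ p.1 ≠ p.2}).Finite := by
      apply Set.Finite.image
      refine ((hfin t).prod (hfin t)).subset ?_
      rintro ⟨a, b⟩ ⟨h, _⟩
      exact h
    have h0 : (0 : ℝ) ∉ (fun p : ℝ × ℝ => |p.1 - p.2|) '' {p | (B t p.1 ∧ B t p.2) ∧ p.1 ≠ p.2} := by
      rintro ⟨p, ⟨_, hne⟩, hp⟩
      exact hne (sub_eq_zero.1 (abs_eq_zero.1 hp))
    have := hf2.isClosed.isOpen_compl.mem_nhds h0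
    obtain ⟨r, hr, hball⟩ := Metric.mem_nhds_iff.1 this
    refine ⟨r / 2, by positivity, fun b b' hb hb' hlt => ?_⟩
    by_contra hne
    refine hball (a := |b - b'|) ?_ ⟨(b, b'), ⟨⟨hb, hb'⟩, hne⟩, rfl⟩
    rw [Metric.mem_ball, Real.dist_eq, sub_zero, abs_abs]
    linarith
  have h3 : ∀ᶠ s in nhds t, ∀ b ∈ {b | B t b}, ∃ b', B s b' ∧ |b - b'| < δ := by
    rw [Filter.eventually_all_finite (hfin t)]
    intro b hb
    obtain ⟨q, hq1, hq2⟩ := exists_rat_btwn (show b - δ < b by linarith)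
    obtain ⟨r, hr1, hr2⟩ := exists_rat_btwn (show b < b + δ by linarith)
    filter_upwards [h2 (q, r) ⟨b, ⟨hq2, hr1⟩, hb⟩] with s hs
    obtain ⟨b', ⟨hb1, hb2⟩, hb'⟩ := hs
    refine ⟨b', hb', ?_⟩
    change (q : ℝ) < b' at hb1
    change b' < (r : ℝ) at hb2
    rw [abs_lt]
    constructor <;> linarith
  obtain ⟨ε, hε, hball⟩ := Metric.eventually_nhds_iff.1 (h1.and h3)
  have near_iff : ∀ d a b, Near d a b ↔ |a - b| < d := by
    intro d a b
    rw [abs_lt, Near]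
    constructor <;> rintro ⟨h, h'⟩ <;> constructor <;> linarith
  refine ⟨δ, ε, hδ, hε, fun s hs => ?_⟩
  obtain ⟨hcard, hnear⟩ := hball (y := s) (by rw [Real.dist_eq]; exact (near_iff _ _ _).1 hs)
  choose! g hg hgn using hnear
  have hinj : InjOn g {b | B t b} := by
    intro a ha b hb hab
    refine hsep a b ha hb ?_
    have e1 := hgn a ha
    have e2 := hgn b hb
    rw [← hab] at e2
    rw [abs_lt] at e1 e2 ⊢
    constructor <;> linarith
  have himg : g '' {b | B t b} = {b | B s b} := by
    refine Set.eq_of_subset_of_ncard_le ?_ ?_ (hfin s)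
    · rintro _ ⟨a, ha, rfl⟩
      exact hg a ha
    · rw [hinj.ncard_image, hcard]
  have key : ∀ b c, B t b → B s c → |b - c| < δ → c = g b := by
    intro b c hb hc hbc
    have : c ∈ g '' {b | B t b} := by rw [himg]; exact hc
    obtain ⟨a, ha, rfl⟩ := this
    have : a = b := by
      refine hsep a b ha hb ?_
      have e1 := hgn a ha
      rw [abs_lt] at e1 hbc ⊢
      constructor <;> linarith
    rw [this]
  simp only [near_iff]
  refine ⟨fun b hb => ⟨g b, hg b hb, hgn b hb⟩, ?_, ?_, ?_⟩
  · intro c hc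
    have : c ∈ g '' {b | B t b} := by rw [himg]; exact hc
    obtain ⟨a, ha, rfl⟩ := this
    exact ⟨a, ha, hgn a ha⟩
  · intro b b' b'' hb hb' hb'' hn hn'
    rw [key b b' hb hb' hn, key b b'' hb hb'' hn']
  · intro b b' c hb hb' hc hn hn'
    exact hinj hb hb' ((key b c hb hc hn).symm.trans (key b' c hb' hc hn'))

/-- Finite set of test points attached to a set of bad points. -/
def TestPt (Z : ℝ → Prop) (t : ℝ) : Prop :=
  t = 0 ∨ ∃ b, ∃ b', Z b ∧ Z b' ∧ (t + t = b + b' ∨ t = b + 1 ∨ t + 1 = b)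

theorem testPt_finite {Z : ℝ → Prop} (h : {t | Z t}.Finite) : {t | TestPt Z t}.Finite := by
  have h1 : ((fun p : ℝ × ℝ => (p.1 + p.2) / 2) '' ({t | Z t} ×ˢ {t | Z t})).Finite :=
    (h.prod h).image _
  have h2 : ((fun p : ℝ => p + 1) '' {t | Z t}).Finite := h.image _
  have h3 : ((fun p : ℝ => p - 1) '' {t | Z t}).Finite := h.image _
  refine ((((finite_singleton (0 : ℝ)).union h1).union h2).union h3).subset ?_
  rintro t (rfl | ⟨b, b', hb, hb', h | h | h⟩)
  · simp
  · exact Or.inl (Or.inl (Or.inr ⟨(b, b'), ⟨hb, hb'⟩, by simp only; linarith⟩))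
  · exact Or.inl (Or.inr ⟨b, hb, h.symm⟩)
  · exact Or.inr ⟨b, hb, by simp only; linarith⟩

theorem testPt_exists {Z : ℝ → Prop} (h : {t | Z t}.Finite) (t : ℝ) :
    ∃ t', TestPt Z t' ∧ (t = t' ∨ ∀ u ∈ uIcc t t', ¬ Z u) := by
  by_cases ht : Z t
  · exact ⟨t, Or.inr ⟨t, t, ht, ht, Or.inl rfl⟩, Or.inl rfl⟩
  have hl : {u | Z u ∧ u < t}.Finite := h.subset fun u hu => hu.1
  have hr : {u | Z u ∧ t < u}.Finite := h.subset fun u hu => hu.1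
  have htri : ∀ u, Z u → u < t ∨ t < u := fun u hu => by
    rcases lt_trichotomy u t with h | h | h
    · exact Or.inl h
    · exact absurd (h ▸ hu) ht
    · exact Or.inr h
  by_cases hle : {u | Z u ∧ u < t}.Nonempty
  · obtain ⟨l, ⟨hlZ, hlt⟩, hlmax⟩ := Set.exists_max_image _ (fun u : ℝ => u) hl hle
    by_cases hre : {u | Z u ∧ t < u}.Nonempty
    · obtain ⟨r, ⟨hrZ, hrt⟩, hrmin⟩ := Set.exists_min_image _ (fun u : ℝ => u) hr hre
      refine ⟨(l + r) / 2, Or.inr ⟨l, r, hlZ, hrZ, Or.inl (by ring)⟩, Or.inr fun u hu hZ => ?_⟩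
      rw [mem_uIcc] at hu
      rcases htri u hZ with h | h
      · have := hlmax u ⟨hZ, h⟩
        rcases hu with hu | hu <;> linarith [hu.1, hu.2]
      · have := hrmin u ⟨hZ, h⟩
        rcases hu with hu | hu <;> linarith [hu.1, hu.2]
    · refine ⟨l + 1, Or.inr ⟨l, l, hlZ, hlZ, Or.inr (Or.inl rfl)⟩, Or.inr fun u hu hZ => ?_⟩
      rw [mem_uIcc] at hu
      rcases htri u hZ with h | h
      · have := hlmax u ⟨hZ, h⟩
        rcases hu with hu | hu <;> linarith [hu.1, hu.2]
      · exact hre ⟨u, hZ, h⟩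
  · by_cases hre : {u | Z u ∧ t < u}.Nonempty
    · obtain ⟨r, ⟨hrZ, hrt⟩, hrmin⟩ := Set.exists_min_image _ (fun u : ℝ => u) hr hre
      refine ⟨r - 1, Or.inr ⟨r, r, hrZ, hrZ, Or.inr (Or.inr (by ring))⟩, Or.inr fun u hu hZ => ?_⟩
      rw [mem_uIcc] at hu
      rcases htri u hZ with h | h
      · exact hle ⟨u, hZ, h⟩
      · have := hrmin u ⟨hZ, h⟩
        rcases hu with hu | hu <;> linarith [hu.1, hu.2]
    · refine ⟨0, Or.inl rfl, Or.inr fun u hu hZ => ?_⟩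
      rcases htri u hZ with h | h
      · exact hle ⟨u, hZ, h⟩
      · exact hre ⟨u, hZ, h⟩

/-- Uniform finiteness for families indexed by `ℝ^ι`. -/
def UF (S : OMinimalStructure) (ι : Type) : Prop :=
  ∀ A : (ι → ℝ) → ℝ → Prop,
    Dd S (Option ι) (fun w => A (fun i => w (some i)) (w none)) →
    (∀ v, {b | A v b}.Finite) → ∃ N : ℕ, ∀ v, {b | A v b}.ncard ≤ N

theorem UF.step {S : OMinimalStructure} {ι : Type} [Fintype ι] (ih : UF S ι) :
    UF S (Option ι) := by
  intro A hA hfin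
  let B : (ι → ℝ) → ℝ → ℝ → Prop := fun x t b => A (fun o => o.elim t x) b
  have hB : ∀ (κ : Type) [Fintype κ] (f : ι → κ) (i j : κ),
      Dd S κ (fun w => B (fun a => w (f a)) (w i) (w j)) := by
    intro κ _ f i j
    refine (hA.comp (fun o => o.elim j (fun o' => o'.elim i f))).congr fun v => ?_
    have : (fun o : Option ι => o.elim (v i) (fun a => v (f a))) =
        fun o => v (o.elim i f) := by
      funext o
      cases o <;> rfl
    change A (fun o : Option ι => o.elim (v i) (fun a => v (f a))) (v j) ↔ _
    rw [this]
    rfl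
  have hBfix : ∀ x, ∀ (κ : Type) [Fintype κ] (i j : κ), Dd S κ (fun w => B x (w i) (w j)) := by
    intro x κ _ i j
    exact Dd.fix (P := fun (w : κ → ℝ) (x : ι → ℝ) => B x (w i) (w j))
      (hB (κ ⊕ ι) Sum.inr (Sum.inl i) (Sum.inl j)) x
  have hbad : ∀ x, {t | ¬ GoodAt (B x) t}.Finite := fun x => planar (hBfix x) (fun t => hfin _)
  have hBadD : ∀ (κ : Type) [Fintype κ] (f : ι → κ) (i : κ),
      Dd S κ (fun w => ¬ GoodAt (B (fun a => w (f a))) (w i)) :=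
    fun κ _ f i => (Dd.goodAt hB κ f i).not
  have hT : ∀ (κ : Type) [Fintype κ] (f : ι → κ) (i : κ),
      Dd S κ (fun w => TestPt (fun t => ¬ GoodAt (B (fun a => w (f a))) t) (w i)) := by
    intro κ _ f i
    unfold TestPt
    refine Dd.or ?_ (Dd.ex (Dd.ex ((hBadD _ _ _).and ((hBadD _ _ _).and
      (Dd.or ?_ (Dd.or ?_ ?_))))))
    · exact (Dd.eq (MvPolynomial.X i) 0).congr (fun v => by simp)
    · exact (Dd.eq (MvPolynomial.X (some (some i)) + MvPolynomial.X (some (some i)))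
        (MvPolynomial.X (some none) + MvPolynomial.X none)).congr (fun v => by simp)
    · exact (Dd.eq (MvPolynomial.X (some (some i)))
        (MvPolynomial.X (some none) + 1)).congr (fun v => by simp)
    · exact (Dd.eq (MvPolynomial.X (some (some i)) + 1)
        (MvPolynomial.X (some none))).congr (fun v => by simp)
  let A' : (ι → ℝ) → ℝ → Prop := fun x b =>
    ∃ t, TestPt (fun t => ¬ GoodAt (B x) t) t ∧ B x t b
  have hA' : Dd S (Option ι) (fun w => A' (fun i => w (some i)) (w none)) :=
    Dd.ex ((hT _ _ _).and (hB _ _ _ _))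
  have hA'fin : ∀ x, {b | A' x b}.Finite := by
    intro x
    refine ((testPt_finite (hbad x)).biUnion (t := fun t => {b | B x t b})
      (fun t _ => hfin _)).subset ?_
    rintro b ⟨t, ht, hb⟩
    exact mem_biUnion (s := {t | TestPt _ t}) ht hb
  obtain ⟨N, hN⟩ := ih A' hA' hA'fin
  refine ⟨N, fun v => ?_⟩
  have hv : v = fun o => o.elim (v none) (fun i => v (some i)) := by
    funext o
    cases o <;> rfl
  obtain ⟨t', ht', h⟩ := testPt_exists (hbad (fun i => v (some i))) (v none)
  have hle : {b | B (fun i => v (some i)) t' b}.ncard ≤ N :=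
    (Set.ncard_le_ncard (t := {b | A' (fun i => v (some i)) b})
      (fun b hb => ⟨t', ht', hb⟩) (hA'fin _)).trans (hN _)
  rw [hv]
  change {b | B (fun i => v (some i)) (v none) b}.ncard ≤ N
  rcases h with h | h
  · rwa [h]
  · rw [ncard_const (B := B (fun i => v (some i))) (t' := t')]
    · exact hle
    · intro u hu
      exact not_not.1 (h u hu)

theorem uf (S : OMinimalStructure) (ι : Type) [Finite ι] : UF S ι := by
  induction ι using Finite.induction_empty_option with
  | of_equiv e h =>
    intro A hA hfin
    obtain ⟨N, hN⟩ := h (fun v b => A (fun i => v (e.symm i)) b)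
      (hA.comp (Option.map e.symm)) (fun v => hfin _)
    refine ⟨N, fun v => ?_⟩
    have := hN (fun i => v (e i))
    simpa using this
  | h_empty =>
    intro A _ _
    refine ⟨{b | A PEmpty.elim b}.ncard, fun v => ?_⟩
    rw [Subsingleton.elim v PEmpty.elim]
  | h_option h => exact UF.step h

/-- The strict lexicographic order on `ℝⁿ`. -/
def LexLt {n : ℕ} (x y : Fin n → ℝ) : Prop := ∃ i, (∀ j, j < i → x j = y j) ∧ x i < y i

theorem lexLt_iff {n : ℕ} (x y : Fin n → ℝ) : LexLt x y ↔ toLex x < toLex y := Iff.rfl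

theorem Dd.lexLt {S : OMinimalStructure} {n : ℕ} {κ : Type} [Fintype κ] (a b : Fin n → κ) :
    Dd S κ (fun w => LexLt (fun i => w (a i)) (fun i => w (b i))) := by
  unfold LexLt
  refine Dd.exists_fin fun i => Dd.and (Dd.forall_fin fun j => ?_) (Dd.ltv _ _)
  by_cases hij : j < i
  · exact (Dd.eqv (a j) (b j)).congr (fun v => by simp [hij])
  · exact (Dd.eq (0 : MvPolynomial κ ℝ) 0).congr (fun v => by simp [hij])

theorem decomp (S : OMinimalStructure) {n m : ℕ} (X : Set (Fin n → ℝ))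
    (f : (Fin n → ℝ) → (Fin m → ℝ))
    (hG : ∀ (κ : Type) [Fintype κ] (a : Fin n → κ) (b : Fin m → κ),
      Dd S κ (fun w => (fun i => w (a i)) ∈ X ∧ (fun j => w (b j)) = f (fun i => w (a i))))
    (hfib : ∀ y : Fin m → ℝ, {x ∈ X | f x = y}.Finite) (c : ℕ) :
    ∀ Y : Set (Fin n → ℝ), Y ⊆ X → Y ∈ S.sets n →
      (∀ y : Fin m → ℝ, {x ∈ Y | f x = y}.ncard ≤ c) →
      ∃ Xs : Fin c → Set (Fin n → ℝ),
        (∀ k, Xs k ∈ S.sets n) ∧ Y = ⋃ k, Xs k ∧ ∀ k, Set.InjOn f (Xs k) := by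
  induction c with
  | zero =>
    intro Y hYX hY hc
    refine ⟨fun _ => ∅, fun k => k.elim0, ?_, fun k => k.elim0⟩
    rw [iUnion_of_empty]
    refine eq_empty_of_forall_notMem fun x hx => ?_
    have hfin : {x' ∈ Y | f x' = f x}.Finite :=
      (hfib (f x)).subset fun z hz => ⟨hYX hz.1, hz.2⟩
    have h0 := (Set.ncard_eq_zero hfin).1 (Nat.le_zero.1 (hc (f x)))
    exact (h0.subset ⟨hx, rfl⟩ : x ∈ (∅ : Set (Fin n → ℝ)))
  | succ c ih =>
    intro Y hYX hY hc
    have hfin : ∀ y, {x' ∈ Y | f x' = y}.Finite := fun y =>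
      (hfib y).subset fun z hz => ⟨hYX hz.1, hz.2⟩
    let M : Set (Fin n → ℝ) :=
      {x | x ∈ Y ∧ ¬ ∃ x' : Fin n → ℝ, x' ∈ Y ∧ LexLt x' x ∧ ∃ y : Fin m → ℝ,
        (x ∈ X ∧ y = f x) ∧ (x' ∈ X ∧ y = f x')}
    have hM : M ∈ S.sets n := by
      refine Dd.mem (Dd.and (Dd.of_mem hY (fun i => i)) (Dd.not (Dd.exv (Dd.and
        (Dd.of_mem hY Sum.inr) (Dd.and (Dd.lexLt Sum.inr Sum.inl)
          (Dd.exv (Dd.and (hG _ _ _) (hG _ _ _))))))))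
    have hMinj : InjOn f M := by
      rintro x ⟨hx, hxm⟩ x' ⟨hx', hxm'⟩ hf
      by_contra hne
      rcases lt_trichotomy (toLex x) (toLex x') with h | h | h
      · exact hxm' ⟨x, hx, h, f x, ⟨hYX hx', hf⟩, ⟨hYX hx, rfl⟩⟩
      · exact hne (toLex.injective h)
      · exact hxm ⟨x', hx', h, f x, ⟨hYX hx, rfl⟩, ⟨hYX hx', hf⟩⟩
    have hcard : ∀ y, {x ∈ Y ∩ Mᶜ | f x = y}.ncard ≤ c := by
      intro y
      rcases Set.eq_empty_or_nonempty {x ∈ Y | f x = y} with he | hne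
      · have : {x ∈ Y ∩ Mᶜ | f x = y} = ∅ :=
          eq_empty_of_forall_notMem fun x hx =>
            (he.subset ⟨hx.1.1, hx.2⟩ : x ∈ (∅ : Set (Fin n → ℝ)))
        rw [this]
        simp
      · obtain ⟨x₀, ⟨hx₀, hfx₀⟩, hmin⟩ :=
          Set.exists_min_image _ (fun x : Fin n → ℝ => toLex x) (hfin y) hne
        have hx₀M : x₀ ∈ M := by
          refine ⟨hx₀, ?_⟩
          rintro ⟨x', hx', hlt, z, ⟨_, hz⟩, ⟨_, hz'⟩⟩
          have hle := hmin x' ⟨hx', by rw [← hz', hz, hfx₀]⟩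
          exact absurd ((lexLt_iff _ _).1 hlt) (not_lt.2 hle)
        have hlt : {x ∈ Y ∩ Mᶜ | f x = y}.ncard < {x ∈ Y | f x = y}.ncard := by
          refine Set.ncard_lt_ncard ⟨fun x hx => ⟨hx.1.1, hx.2⟩, fun hsub => ?_⟩ (hfin y)
          exact (hsub ⟨hx₀, hfx₀⟩).1.2 hx₀M
        have := hc y
        omega
    obtain ⟨Xs, h1, h2, h3⟩ := ih (Y ∩ Mᶜ) (fun x hx => hYX hx.1)
      (S.inter_mem hY (S.compl_mem hM)) hcard
    refine ⟨Fin.cons M Xs, ?_, ?_, ?_⟩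
    · intro k
      refine Fin.cases ?_ (fun k => ?_) k
      · exact hM
      · exact h1 k
    · ext x
      rw [mem_iUnion, Fin.exists_fin_succ]
      simp only [Fin.cons_zero, Fin.cons_succ]
      rw [← mem_iUnion, ← h2]
      constructor
      · intro hx
        by_cases hxM : x ∈ M
        · exact Or.inl hxM
        · exact Or.inr ⟨hx, hxM⟩
      · rintro (hx | hx)
        · exact hx.1
        · exact hx.1
    · intro k
      refine Fin.cases ?_ (fun k => ?_) k
      · exact hMinj
      · exact h3 k

/-- Let `𝔖` be an o-minimal structure, `X ⊂ ℝⁿ` definable in `𝔖`, and `f : X → ℝ^m`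
definable with all fibers finite. Then there is a uniform bound `c` such that every
fiber of `f` has at most `c` elements, and `X` can be written as a union of at most `c`
definable sets on each of which `f` is injective. -/
theorem stmt_18 (S : OMinimalStructure) {n m : ℕ}
    (X : Set (Fin n → ℝ)) (hX : X ∈ S.sets n)
    (f : (Fin n → ℝ) → (Fin m → ℝ)) (hf : functionGraph X f ∈ S.sets (n + m))
    (hfib : ∀ y : Fin m → ℝ, {x ∈ X | f x = y}.Finite) :
    ∃ c : ℕ,
      (∀ y : Fin m → ℝ, {x ∈ X | f x = y}.ncard ≤ c) ∧
      ∃ Xs : Fin c → Set (Fin n → ℝ),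
        (∀ k, Xs k ∈ S.sets n) ∧
        X = ⋃ k, Xs k ∧
        ∀ k, Set.InjOn f (Xs k) := by
  have hG : ∀ (κ : Type) [Fintype κ] (a : Fin n → κ) (b : Fin m → κ),
      Dd S κ (fun w => (fun i => w (a i)) ∈ X ∧
        (fun j => w (b j)) = f (fun i => w (a i))) := by
    intro κ _ a b
    exact (Dd.of_mem hf (Fin.append a b)).congr (fun v => by simp [functionGraph])
  have hfin : ∀ (i : Fin n) (y : Fin m → ℝ),
      {t : ℝ | ∃ x : Fin n → ℝ, (x ∈ X ∧ y = f x) ∧ x i = t}.Finite := by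
    intro i y
    refine ((hfib y).image (fun x => x i)).subset ?_
    rintro t ⟨x, ⟨hx, hy⟩, ht⟩
    exact ⟨x, ⟨hx, hy.symm⟩, ht⟩
  have hN : ∀ i : Fin n, ∃ N : ℕ, ∀ y : Fin m → ℝ,
      {t : ℝ | ∃ x : Fin n → ℝ, (x ∈ X ∧ y = f x) ∧ x i = t}.ncard ≤ N := by
    intro i
    refine uf S (Fin m) (fun y t => ∃ x : Fin n → ℝ, (x ∈ X ∧ y = f x) ∧ x i = t) ?_ (hfin i)
    exact Dd.exv (Dd.and (hG _ _ _) (Dd.eqv _ _))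
  choose N hN using hN
  have hbound : ∀ y : Fin m → ℝ, {x ∈ X | f x = y}.ncard ≤ ∏ i, N i := by
    intro y
    have hsub : {x ∈ X | f x = y} ⊆
        (Fintype.piFinset (fun i => (hfin i y).toFinset) : Finset (Fin n → ℝ)) := by
      rintro x ⟨hx, hy⟩
      rw [Finset.mem_coe, Fintype.mem_piFinset]
      intro i
      rw [Set.Finite.mem_toFinset]
      exact ⟨x, ⟨hx, hy.symm⟩, rfl⟩
    refine (Set.ncard_le_ncard hsub (Finset.finite_toSet _)).trans ?_
    rw [Set.ncard_coe_finset, Fintype.card_piFinset]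
    refine Finset.prod_le_prod' fun i _ => ?_
    rw [← Set.ncard_eq_toFinset_card _ (hfin i y)]
    exact hN i y
  exact ⟨∏ i, N i, hbound, decomp S X f hG hfib _ X Subset.rfl hX hbound⟩
end
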